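/- For every natural number n there exists a consistent and complete theory T extending Q + Πₙ-Th(ℕ) (Robinson arithmetic together with all true Πₙ-sentences) whose set of (Gödel numbers of) axioms is definable in ℕ by a Σ_{n+2}-formula; here complete means that for every sentence φ of arithmetic, either T ⊢ φ or T ⊢ ¬φ. -/

import Mathlib

/-!
Formalization of results from "Gödel–Rosser's Incompleteness Theorems for
non-RE Theories" (Salehi & Seraji).

We work in the first-order language of arithmetic `{0, S, +, ×, ≤}` with the
standard model `ℕ`.  Provability `T ⊢ φ` is rendered as the semantic
consequence `T ⊨ᵇ φ` of Mathlib's model theory library, which by the Gödel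
completeness theorem coincides with provability in first-order logic.
-/

open FirstOrder Language BoundedFormula

namespace GRNonRE

/-- Function symbols of arithmetic: `0`, `S`, `+`, `×`. -/
inductive ArithFunc : ℕ → Type
  | zero : ArithFunc 0
  | succ : ArithFunc 1
  | add  : ArithFunc 2
  | mul  : ArithFunc 2

/-- The relation symbol `≤`. -/
inductive ArithRel : ℕ → Type
  | le : ArithRel 2

/-- The first-order language of arithmetic `{0, S, +, ×, ≤}`. -/
def LA : FirstOrder.Language := ⟨ArithFunc, ArithRel⟩

/-- The standard model `ℕ`. -/
instance : LA.Structure ℕ where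
  funMap {_} f := match f with
    | ArithFunc.zero => fun _ => 0
    | ArithFunc.succ => fun v => v 0 + 1
    | ArithFunc.add  => fun v => v 0 + v 1
    | ArithFunc.mul  => fun v => v 0 * v 1
  RelMap {_} r := match r with
    | ArithRel.le => fun v => v 0 ≤ v 1

def zeroT {α : Type} : LA.Term α := Term.func ArithFunc.zero ![]
def succT {α : Type} (t : LA.Term α) : LA.Term α := Term.func ArithFunc.succ ![t]
def addT {α : Type} (t s : LA.Term α) : LA.Term α := Term.func ArithFunc.add ![t, s]
def mulT {α : Type} (t s : LA.Term α) : LA.Term α := Term.func ArithFunc.mul ![t, s]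

/-- The atomic formula `t ≤ s`. -/
def leF {α : Type} {n : ℕ} (t s : LA.Term (α ⊕ Fin n)) : LA.BoundedFormula α n :=
  BoundedFormula.rel ArithRel.le ![t, s]

/-- The numeral `m̄ = S (S ⋯ (S 0))` representing `m : ℕ`. -/
def numeral : ℕ → LA.Term Empty
  | 0 => zeroT
  | n + 1 => succT (numeral n)

instance : Encodable (Σ n, LA.Functions n) :=
  ⟨fun f => match f with
    | ⟨_, ArithFunc.zero⟩ => 0
    | ⟨_, ArithFunc.succ⟩ => 1
    | ⟨_, ArithFunc.add⟩ => 2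
    | ⟨_, ArithFunc.mul⟩ => 3,
   fun n => match n with
    | 0 => some ⟨0, ArithFunc.zero⟩
    | 1 => some ⟨1, ArithFunc.succ⟩
    | 2 => some ⟨2, ArithFunc.add⟩
    | 3 => some ⟨2, ArithFunc.mul⟩
    | _ => none,
   by rintro ⟨n, f⟩; cases f <;> rfl⟩

instance : Encodable (Σ n, LA.Relations n) :=
  ⟨fun _ => 0,
   fun n => match n with
    | 0 => some ⟨2, ArithRel.le⟩
    | _ => none,
   by rintro ⟨n, r⟩; cases r; rfl⟩

/-- A standard Gödel numbering of formulas, obtained from Mathlib's structural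
encoding of bounded formulas as lists of symbols. -/
def godel {k : ℕ} (φ : LA.BoundedFormula Empty k) : ℕ :=
  Encodable.encode φ.listEncode

/-- Lift a term in context `k` to context `k + 1`. -/
def liftT {k : ℕ} (t : LA.Term (Empty ⊕ Fin k)) : LA.Term (Empty ⊕ Fin (k + 1)) :=
  t.relabel (Sum.map id Fin.castSucc)

/-- The class `Σ₀ = Π₀ = Δ₀` of bounded formulas: built from atomic formulas by
Boolean connectives (`⊥` and `⟹`, from which `∼`, `⊓`, `⊔` are definable) and
bounded universal quantification `∀ x ≤ t, φ` (bounded existential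
quantification `∃ x ≤ t, φ` is expressible as `∼ ∀ x ≤ t, ∼φ`). -/
inductive Delta0 : ∀ {k : ℕ}, LA.BoundedFormula Empty k → Prop
  | falsum {k : ℕ} : Delta0 (⊥ : LA.BoundedFormula Empty k)
  | equal {k : ℕ} (t₁ t₂ : LA.Term (Empty ⊕ Fin k)) : Delta0 (t₁ =' t₂)
  | le {k : ℕ} (t₁ t₂ : LA.Term (Empty ⊕ Fin k)) : Delta0 (leF t₁ t₂)
  | imp {k : ℕ} {φ ψ : LA.BoundedFormula Empty k} :
      Delta0 φ → Delta0 ψ → Delta0 (φ ⟹ ψ)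
  | bdall {k : ℕ} (t : LA.Term (Empty ⊕ Fin k)) {φ : LA.BoundedFormula Empty (k + 1)} :
      Delta0 φ → Delta0 ((leF (&(Fin.last k)) (liftT t) ⟹ φ).all)

mutual
  /-- The classes `Σₙ` of the arithmetical hierarchy: `Σ₀` is the class of
  bounded formulas, and `Σ_{n+1}` contains `Πₙ` and is closed under `⊓`, `⊔`,
  existential quantification and bounded universal quantification. -/
  inductive IsSigma : ℕ → ∀ {k : ℕ}, LA.BoundedFormula Empty k → Prop
    | ofDelta0 {k : ℕ} {φ : LA.BoundedFormula Empty k} : Delta0 φ → IsSigma 0 φ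
    | ofPi {n k : ℕ} {φ : LA.BoundedFormula Empty k} :
        IsPi n φ → IsSigma (n + 1) φ
    | ex {n k : ℕ} {φ : LA.BoundedFormula Empty (k + 1)} :
        IsSigma (n + 1) φ → IsSigma (n + 1) φ.ex
    | inf {n k : ℕ} {φ ψ : LA.BoundedFormula Empty k} :
        IsSigma (n + 1) φ → IsSigma (n + 1) ψ → IsSigma (n + 1) (φ ⊓ ψ)
    | sup {n k : ℕ} {φ ψ : LA.BoundedFormula Empty k} :
        IsSigma (n + 1) φ → IsSigma (n + 1) ψ → IsSigma (n + 1) (φ ⊔ ψ)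
    | bdall {n k : ℕ} (t : LA.Term (Empty ⊕ Fin k))
        {φ : LA.BoundedFormula Empty (k + 1)} :
        IsSigma (n + 1) φ → IsSigma (n + 1) ((leF (&(Fin.last k)) (liftT t) ⟹ φ).all)

  /-- The classes `Πₙ` of the arithmetical hierarchy: `Π₀` is the class of
  bounded formulas, and `Π_{n+1}` contains `Σₙ` and is closed under `⊓`, `⊔`,
  universal quantification and bounded existential quantification. -/
  inductive IsPi : ℕ → ∀ {k : ℕ}, LA.BoundedFormula Empty k → Prop
    | ofDelta0 {k : ℕ} {φ : LA.BoundedFormula Empty k} : Delta0 φ → IsPi 0 φ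
    | ofSigma {n k : ℕ} {φ : LA.BoundedFormula Empty k} :
        IsSigma n φ → IsPi (n + 1) φ
    | all {n k : ℕ} {φ : LA.BoundedFormula Empty (k + 1)} :
        IsPi (n + 1) φ → IsPi (n + 1) φ.all
    | inf {n k : ℕ} {φ ψ : LA.BoundedFormula Empty k} :
        IsPi (n + 1) φ → IsPi (n + 1) ψ → IsPi (n + 1) (φ ⊓ ψ)
    | sup {n k : ℕ} {φ ψ : LA.BoundedFormula Empty k} :
        IsPi (n + 1) φ → IsPi (n + 1) ψ → IsPi (n + 1) (φ ⊔ ψ)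
    | bdex {n k : ℕ} (t : LA.Term (Empty ⊕ Fin k))
        {φ : LA.BoundedFormula Empty (k + 1)} :
        IsPi (n + 1) φ → IsPi (n + 1) ((leF (&(Fin.last k)) (liftT t) ⊓ φ).ex)
end

/-- `T ⊢ φ`: by the Gödel completeness theorem, provability of the sentence `φ`
from the theory `T` coincides with the semantic consequence relation. -/
def Proves (T : LA.Theory) (φ : LA.Sentence) : Prop := T ⊨ᵇ φ

/-- Consistency of a theory. -/
def Consistent (T : LA.Theory) : Prop := ¬ Proves T ⊥

/-- `ψ(m̄)`: the result of substituting the numeral `m̄` for the free variable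
of a formula `ψ(x)` with one free variable. -/
def subst1 (ψ : LA.BoundedFormula Empty 1) (m : ℕ) : LA.Sentence :=
  ψ.toFormula.subst fun _ => numeral m

/-- `n`-consistency: there is no formula `ψ(x) ∈ Π_{n-1}` such that `T ⊢ ¬ψ(m̄)`
for every numeral `m̄` (`m ∈ ℕ`) and yet `T ⊢ ∃x ψ(x)`.
(`0`-consistency is ordinary consistency.) -/
def NCon : ℕ → LA.Theory → Prop
  | 0, T => Consistent T
  | n + 1, T => ¬ ∃ ψ : LA.BoundedFormula Empty 1, IsPi n ψ ∧
      (∀ m : ℕ, Proves T (∼(subst1 ψ m))) ∧ Proves T ψ.ex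

/-- The axioms of Robinson arithmetic `Q`:
`Sx ≠ 0`, `Sx = Sy → x = y`, `x ≠ 0 → ∃y x = Sy`, `x + 0 = x`,
`x + Sy = S(x + y)`, `x·0 = 0`, `x·Sy = x·y + x`, `x ≤ y ↔ ∃z z + x = y`. -/
def QTheory : LA.Theory :=
  { ∀' ∼(succT (&0) =' zeroT),
    ∀' ∀' ((succT (&0) =' succT (&1)) ⟹ (&0 =' &1)),
    ∀' (∼(&0 =' zeroT) ⟹ ∃' (&0 =' succT (&1))),
    ∀' (addT (&0) zeroT =' &0),
    ∀' ∀' (addT (&0) (succT (&1)) =' succT (addT (&0) (&1))),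
    ∀' (mulT (&0) zeroT =' zeroT),
    ∀' ∀' (mulT (&0) (succT (&1)) =' addT (mulT (&0) (&1)) (&0)),
    ((leF (&0) (&1) ⇔ ∃' (addT (&2) (&0) =' (&1)) : LA.BoundedFormula Empty 2)).alls }

/-- `T` is an extension of Robinson arithmetic `Q` (i.e. `T` proves `Q`). -/
def ExtendsQ (T : LA.Theory) : Prop := ∀ φ ∈ QTheory, Proves T φ

/-- `Πₙ-Th(ℕ)`: the set of `Πₙ`-sentences true in the standard model. -/
def PiTh (n : ℕ) : LA.Theory := {φ | IsPi n φ ∧ ℕ ⊨ φ}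

/-- Soundness: every theorem of `T` is true in `ℕ`. -/
def Sound (T : LA.Theory) : Prop := ∀ φ : LA.Sentence, Proves T φ → ℕ ⊨ φ

/-- `Σₙ`-soundness: every `Σₙ`-sentence provable in `T` is true in `ℕ`. -/
def SigmaSound (n : ℕ) (T : LA.Theory) : Prop :=
  ∀ φ : LA.Sentence, IsSigma n φ → Proves T φ → ℕ ⊨ φ

/-- A formula `Ψ(x)` with one free variable defines the set `A ⊆ ℕ` in `ℕ`. -/
def Defines (Ψ : LA.BoundedFormula Empty 1) (A : Set ℕ) : Prop :=
  ∀ m : ℕ, m ∈ A ↔ Ψ.Realize (fun e => Empty.elim e) ![m]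

/-- `A ⊆ ℕ` is definable in `ℕ` by a `Σₙ`-formula. -/
def SigmaDefinable (n : ℕ) (A : Set ℕ) : Prop := ∃ Ψ, IsSigma n Ψ ∧ Defines Ψ A

/-- `A ⊆ ℕ` is definable in `ℕ` by a `Πₙ`-formula. -/
def PiDefinable (n : ℕ) (A : Set ℕ) : Prop := ∃ Ψ, IsPi n Ψ ∧ Defines Ψ A

/-- The set of Gödel numbers of the axioms of `T`. -/
def axiomCodes (T : LA.Theory) : Set ℕ := {m | ∃ φ ∈ T, godel φ = m}

/-- The set of Gödel numbers of the theorems of `T` (its deductive closure). -/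
def theoremCodes (T : LA.Theory) : Set ℕ := {m | ∃ φ, Proves T φ ∧ godel φ = m}

/-! ### Arithmetical definability in the standard model -/

/-- Truth of a formula in `ℕ` under an assignment of its variables. -/
abbrev Holds {k : ℕ} (φ : LA.BoundedFormula Empty k) (v : Fin k → ℕ) : Prop :=
  φ.Realize (fun e => Empty.elim e) v

/-- The value of a term in `ℕ` under an assignment of its variables. -/
abbrev value {k : ℕ} (t : LA.Term (Empty ⊕ Fin k)) (v : Fin k → ℕ) : ℕ :=
  t.realize (Sum.elim (fun e => Empty.elim e) v)

theorem models_iff_holds (φ : LA.Sentence) (v : Fin 0 → ℕ) : ℕ ⊨ φ ↔ Holds φ v :=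
  iff_of_eq (congrArg₂ (BoundedFormula.Realize (M := ℕ) φ) (Subsingleton.elim _ _)
    (Subsingleton.elim _ _))

section Realize

variable {α : Type} (v : α → ℕ) (t s : LA.Term α)

@[simp] theorem realize_zeroT : (zeroT : LA.Term α).realize v = 0 := rfl
@[simp] theorem realize_succT : (succT t).realize v = t.realize v + 1 := rfl
@[simp] theorem realize_addT : (addT t s).realize v = t.realize v + s.realize v := rfl
@[simp] theorem realize_mulT : (mulT t s).realize v = t.realize v * s.realize v := rfl

@[simp] theorem realize_leF {n : ℕ} (e : α → ℕ) (x : Fin n → ℕ) (t s : LA.Term (α ⊕ Fin n)) :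
    (leF t s).Realize e x ↔ t.realize (Sum.elim e x) ≤ s.realize (Sum.elim e x) := Iff.rfl

end Realize

theorem value_liftT {k : ℕ} (t : LA.Term (Empty ⊕ Fin k)) (v : Fin k → ℕ) (x : ℕ) :
    (liftT t).realize (Sum.elim (fun e => Empty.elim e) (Fin.snoc v x : Fin (k + 1) → ℕ)) =
      value t v := by
  rw [liftT, Term.realize_relabel]
  congr 1
  funext i
  rcases i with i | i
  · exact i.elim
  · simp

theorem holds_bdall {k : ℕ} (t : LA.Term (Empty ⊕ Fin k)) (φ : LA.BoundedFormula Empty (k + 1))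
    (v : Fin k → ℕ) :
    Holds (leF (&(Fin.last k)) (liftT t) ⟹ φ).all v ↔ ∀ x ≤ value t v, Holds φ (Fin.snoc v x) := by
  simp [Holds, value_liftT]

theorem holds_bdex {k : ℕ} (t : LA.Term (Empty ⊕ Fin k)) (φ : LA.BoundedFormula Empty (k + 1))
    (v : Fin k → ℕ) :
    Holds (leF (&(Fin.last k)) (liftT t) ⊓ φ).ex v ↔ ∃ x ≤ value t v, Holds φ (Fin.snoc v x) := by
  simp [Holds, value_liftT]

theorem holds_inf {k : ℕ} {φ ψ : LA.BoundedFormula Empty k} {v : Fin k → ℕ} :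
    Holds (φ ⊓ ψ) v ↔ Holds φ v ∧ Holds ψ v := realize_inf

theorem holds_sup {k : ℕ} {φ ψ : LA.BoundedFormula Empty k} {v : Fin k → ℕ} :
    Holds (φ ⊔ ψ) v ↔ Holds φ v ∨ Holds ψ v := realize_sup

theorem Delta0.not {k : ℕ} {φ : LA.BoundedFormula Empty k} (h : Delta0 φ) : Delta0 (∼φ) :=
  h.imp .falsum

mutual

theorem IsSigma.succ : ∀ {n k : ℕ} {φ : LA.BoundedFormula Empty k},
    IsSigma n φ → IsSigma (n + 1) φ
  | _, _, _, .ofDelta0 h => .ofPi (.ofDelta0 h)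
  | _, _, _, .ofPi h => .ofPi h.succ
  | _, _, _, .ex h => h.succ.ex
  | _, _, _, .inf h₁ h₂ => h₁.succ.inf h₂.succ
  | _, _, _, .sup h₁ h₂ => h₁.succ.sup h₂.succ
  | _, _, _, .bdall t h => h.succ.bdall t

theorem IsPi.succ : ∀ {n k : ℕ} {φ : LA.BoundedFormula Empty k},
    IsPi n φ → IsPi (n + 1) φ
  | _, _, _, .ofDelta0 h => .ofSigma (.ofDelta0 h)
  | _, _, _, .ofSigma h => .ofSigma h.succ
  | _, _, _, .all h => h.succ.all
  | _, _, _, .inf h₁ h₂ => h₁.succ.inf h₂.succ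
  | _, _, _, .sup h₁ h₂ => h₁.succ.sup h₂.succ
  | _, _, _, .bdex t h => h.succ.bdex t

end

mutual

theorem IsSigma.exists_not : ∀ {n k : ℕ} {φ : LA.BoundedFormula Empty k}, IsSigma n φ →
    ∃ ψ : LA.BoundedFormula Empty k, IsPi n ψ ∧ ∀ v, Holds ψ v ↔ ¬ Holds φ v
  | _, _, φ, .ofDelta0 h => ⟨∼φ, .ofDelta0 h.not, fun _ => realize_not⟩
  | _, _, _, .ofPi h =>
    let ⟨ψ, hψ, e⟩ := h.exists_not
    ⟨ψ, .ofSigma hψ, e⟩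
  | _, _, _, .ex h =>
    let ⟨ψ, hψ, e⟩ := h.exists_not
    ⟨ψ.all, hψ.all, fun v => by simp [Holds, ← e]⟩
  | _, _, _, .inf h₁ h₂ =>
    let ⟨ψ₁, hψ₁, e₁⟩ := h₁.exists_not
    let ⟨ψ₂, hψ₂, e₂⟩ := h₂.exists_not
    ⟨ψ₁ ⊔ ψ₂, hψ₁.sup hψ₂, fun v => by rw [holds_sup, e₁, e₂, holds_inf]; tauto⟩
  | _, _, _, .sup h₁ h₂ =>
    let ⟨ψ₁, hψ₁, e₁⟩ := h₁.exists_not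
    let ⟨ψ₂, hψ₂, e₂⟩ := h₂.exists_not
    ⟨ψ₁ ⊓ ψ₂, hψ₁.inf hψ₂, fun v => by rw [holds_inf, e₁, e₂, holds_sup]; tauto⟩
  | _, _, _, .bdall t h =>
    let ⟨ψ, hψ, e⟩ := h.exists_not
    ⟨_, hψ.bdex t, fun v => by rw [holds_bdex, holds_bdall]; simp [e]⟩

theorem IsPi.exists_not : ∀ {n k : ℕ} {φ : LA.BoundedFormula Empty k}, IsPi n φ →
    ∃ ψ : LA.BoundedFormula Empty k, IsSigma n ψ ∧ ∀ v, Holds ψ v ↔ ¬ Holds φ v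
  | _, _, φ, .ofDelta0 h => ⟨∼φ, .ofDelta0 h.not, fun _ => realize_not⟩
  | _, _, _, .ofSigma h =>
    let ⟨ψ, hψ, e⟩ := h.exists_not
    ⟨ψ, .ofPi hψ, e⟩
  | _, _, _, .all h =>
    let ⟨ψ, hψ, e⟩ := h.exists_not
    ⟨ψ.ex, hψ.ex, fun v => by simp [Holds, ← e]⟩
  | _, _, _, .inf h₁ h₂ =>
    let ⟨ψ₁, hψ₁, e₁⟩ := h₁.exists_not
    let ⟨ψ₂, hψ₂, e₂⟩ := h₂.exists_not
    ⟨ψ₁ ⊔ ψ₂, hψ₁.sup hψ₂, fun v => by rw [holds_sup, e₁, e₂, holds_inf]; tauto⟩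
  | _, _, _, .sup h₁ h₂ =>
    let ⟨ψ₁, hψ₁, e₁⟩ := h₁.exists_not
    let ⟨ψ₂, hψ₂, e₂⟩ := h₂.exists_not
    ⟨ψ₁ ⊓ ψ₂, hψ₁.inf hψ₂, fun v => by rw [holds_inf, e₁, e₂, holds_sup]; tauto⟩
  | _, _, _, .bdex t h =>
    let ⟨ψ, hψ, e⟩ := h.exists_not
    ⟨_, hψ.bdall t, fun v => by rw [holds_bdex, holds_bdall]; simp [e]⟩

end

/-- The assignment of values to the variables of a formula induced by a renaming
extends along a quantifier. -/
theorem snoc_comp_rename {k m : ℕ} (σ : Fin k → Fin m) (v : Fin m → ℕ) (x : ℕ) :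
    (fun i => (Fin.snoc v x : Fin (m + 1) → ℕ)
      ((Fin.snoc (fun j => (σ j).castSucc) (Fin.last m) : Fin (k + 1) → Fin (m + 1)) i)) =
      (Fin.snoc (fun i => v (σ i)) x : Fin (k + 1) → ℕ) := by
  funext i
  refine Fin.lastCases ?_ (fun j => ?_) i <;> simp

theorem value_rename {k m : ℕ} (σ : Fin k → Fin m) (t : LA.Term (Empty ⊕ Fin k))
    (v : Fin m → ℕ) : value (t.relabel (Sum.map id σ)) v = value t (fun i => v (σ i)) := by
  rw [value, Term.realize_relabel]
  congr 1
  funext i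
  rcases i with i | i
  · exact i.elim
  · rfl

theorem Delta0.exists_rename {k : ℕ} {φ : LA.BoundedFormula Empty k} (h : Delta0 φ) :
    ∀ {m : ℕ} (σ : Fin k → Fin m), ∃ ψ : LA.BoundedFormula Empty m, Delta0 ψ ∧
      ∀ v, Holds ψ v ↔ Holds φ (fun i => v (σ i)) := by
  induction h with
  | falsum => exact fun σ => ⟨⊥, .falsum, fun _ => Iff.rfl⟩
  | equal t₁ t₂ =>
    refine fun σ => ⟨_, .equal (t₁.relabel (Sum.map id σ)) (t₂.relabel (Sum.map id σ)), fun v => ?_⟩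
    simp only [Holds, realize_bdEqual]
    rw [← value, ← value, value_rename, value_rename]
  | le t₁ t₂ =>
    refine fun σ => ⟨_, .le (t₁.relabel (Sum.map id σ)) (t₂.relabel (Sum.map id σ)), fun v => ?_⟩
    simp only [Holds, realize_leF]
    rw [← value, ← value, value_rename, value_rename]
  | imp _ _ ih₁ ih₂ =>
    intro m σ
    obtain ⟨ψ₁, h₁, e₁⟩ := ih₁ σ
    obtain ⟨ψ₂, h₂, e₂⟩ := ih₂ σ
    exact ⟨_, h₁.imp h₂, fun v => by simp only [Holds, realize_imp] at e₁ e₂ ⊢; rw [e₁, e₂]⟩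
  | bdall t _ ih =>
    intro m σ
    obtain ⟨ψ, h, e⟩ := ih (Fin.snoc (fun j => (σ j).castSucc) (Fin.last m))
    refine ⟨_, h.bdall (t.relabel (Sum.map id σ)), fun v => ?_⟩
    simp only [holds_bdall, value_rename, e, snoc_comp_rename]

mutual

theorem IsSigma.exists_rename : ∀ {n k : ℕ} {φ : LA.BoundedFormula Empty k}, IsSigma n φ →
    ∀ {m : ℕ} (σ : Fin k → Fin m), ∃ ψ : LA.BoundedFormula Empty m, IsSigma n ψ ∧
      ∀ v, Holds ψ v ↔ Holds φ (fun i => v (σ i))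
  | _, _, _, .ofDelta0 h, _, σ =>
    let ⟨ψ, hψ, e⟩ := h.exists_rename σ
    ⟨ψ, .ofDelta0 hψ, e⟩
  | _, _, _, .ofPi h, _, σ =>
    let ⟨ψ, hψ, e⟩ := h.exists_rename σ
    ⟨ψ, .ofPi hψ, e⟩
  | _, _, _, .ex h, m, σ =>
    let ⟨ψ, hψ, e⟩ := h.exists_rename (Fin.snoc (fun j => (σ j).castSucc) (Fin.last m))
    ⟨ψ.ex, hψ.ex, fun v => by simp only [Holds, realize_ex] at e ⊢; simp only [e, snoc_comp_rename]⟩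
  | _, _, _, .inf h₁ h₂, _, σ =>
    let ⟨ψ₁, hψ₁, e₁⟩ := h₁.exists_rename σ
    let ⟨ψ₂, hψ₂, e₂⟩ := h₂.exists_rename σ
    ⟨ψ₁ ⊓ ψ₂, hψ₁.inf hψ₂, fun v => by rw [holds_inf, e₁, e₂, holds_inf]⟩
  | _, _, _, .sup h₁ h₂, _, σ =>
    let ⟨ψ₁, hψ₁, e₁⟩ := h₁.exists_rename σ
    let ⟨ψ₂, hψ₂, e₂⟩ := h₂.exists_rename σ
    ⟨ψ₁ ⊔ ψ₂, hψ₁.sup hψ₂, fun v => by rw [holds_sup, e₁, e₂, holds_sup]⟩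
  | _, _, _, .bdall t h, m, σ =>
    let ⟨ψ, hψ, e⟩ := h.exists_rename (Fin.snoc (fun j => (σ j).castSucc) (Fin.last m))
    ⟨_, hψ.bdall (t.relabel (Sum.map id σ)), fun v => by
      simp only [holds_bdall, value_rename, e, snoc_comp_rename]⟩

theorem IsPi.exists_rename : ∀ {n k : ℕ} {φ : LA.BoundedFormula Empty k}, IsPi n φ →
    ∀ {m : ℕ} (σ : Fin k → Fin m), ∃ ψ : LA.BoundedFormula Empty m, IsPi n ψ ∧
      ∀ v, Holds ψ v ↔ Holds φ (fun i => v (σ i))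
  | _, _, _, .ofDelta0 h, _, σ =>
    let ⟨ψ, hψ, e⟩ := h.exists_rename σ
    ⟨ψ, .ofDelta0 hψ, e⟩
  | _, _, _, .ofSigma h, _, σ =>
    let ⟨ψ, hψ, e⟩ := h.exists_rename σ
    ⟨ψ, .ofSigma hψ, e⟩
  | _, _, _, .all h, m, σ =>
    let ⟨ψ, hψ, e⟩ := h.exists_rename (Fin.snoc (fun j => (σ j).castSucc) (Fin.last m))
    ⟨ψ.all, hψ.all, fun v => by
      simp only [Holds, realize_all] at e ⊢; simp only [e, snoc_comp_rename]⟩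
  | _, _, _, .inf h₁ h₂, _, σ =>
    let ⟨ψ₁, hψ₁, e₁⟩ := h₁.exists_rename σ
    let ⟨ψ₂, hψ₂, e₂⟩ := h₂.exists_rename σ
    ⟨ψ₁ ⊓ ψ₂, hψ₁.inf hψ₂, fun v => by rw [holds_inf, e₁, e₂, holds_inf]⟩
  | _, _, _, .sup h₁ h₂, _, σ =>
    let ⟨ψ₁, hψ₁, e₁⟩ := h₁.exists_rename σ
    let ⟨ψ₂, hψ₂, e₂⟩ := h₂.exists_rename σ
    ⟨ψ₁ ⊔ ψ₂, hψ₁.sup hψ₂, fun v => by rw [holds_sup, e₁, e₂, holds_sup]⟩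
  | _, _, _, .bdex t h, m, σ =>
    let ⟨ψ, hψ, e⟩ := h.exists_rename (Fin.snoc (fun j => (σ j).castSucc) (Fin.last m))
    ⟨_, hψ.bdex (t.relabel (Sum.map id σ)), fun v => by
      simp only [holds_bdex, value_rename, e, snoc_comp_rename]⟩

end

/-- The relation `R` on `ℕ` is definable in `ℕ` by a `Σ_{k+1}`-formula. -/
def SigRel (k : ℕ) {n : ℕ} (R : (Fin n → ℕ) → Prop) : Prop :=
  ∃ φ : LA.BoundedFormula Empty n, IsSigma (k + 1) φ ∧ ∀ v, Holds φ v ↔ R v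

/-- The function `f` is the value function of a term. -/
def IsTermFun {n : ℕ} (f : (Fin n → ℕ) → ℕ) : Prop :=
  ∃ t : LA.Term (Empty ⊕ Fin n), ∀ v, value t v = f v

namespace IsTermFun

variable {n : ℕ} {f g : (Fin n → ℕ) → ℕ}

theorem proj (i : Fin n) : IsTermFun fun v => v i := ⟨Term.var (Sum.inr i), fun _ => rfl⟩

theorem zero : IsTermFun fun _ : Fin n → ℕ => 0 := ⟨zeroT, fun _ => rfl⟩

theorem succ (hf : IsTermFun f) : IsTermFun fun v => f v + 1 :=
  let ⟨t, ht⟩ := hf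
  ⟨succT t, fun v => congrArg (· + 1) (ht v)⟩

theorem add (hf : IsTermFun f) (hg : IsTermFun g) : IsTermFun fun v => f v + g v :=
  let ⟨t, ht⟩ := hf
  let ⟨s, hs⟩ := hg
  ⟨addT t s, fun v => congrArg₂ (· + ·) (ht v) (hs v)⟩

theorem mul (hf : IsTermFun f) (hg : IsTermFun g) : IsTermFun fun v => f v * g v :=
  let ⟨t, ht⟩ := hf
  let ⟨s, hs⟩ := hg
  ⟨mulT t s, fun v => congrArg₂ (· * ·) (ht v) (hs v)⟩

end IsTermFun

namespace SigRel

variable {k n : ℕ} {R S : (Fin n → ℕ) → Prop} {f g : (Fin n → ℕ) → ℕ}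

theorem congr (h : SigRel k R) (e : ∀ v, R v ↔ S v) : SigRel k S :=
  let ⟨φ, hφ, hR⟩ := h
  ⟨φ, hφ, fun v => (hR v).trans (e v)⟩

theorem rename {m : ℕ} (h : SigRel k R) (σ : Fin n → Fin m) :
    SigRel k fun v : Fin m → ℕ => R fun i => v (σ i) :=
  let ⟨_, hφ, e⟩ := h
  let ⟨ψ, hψ, e'⟩ := hφ.exists_rename σ
  ⟨ψ, hψ, fun v => (e' v).trans (e _)⟩

theorem and (hR : SigRel k R) (hS : SigRel k S) : SigRel k fun v => R v ∧ S v :=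
  let ⟨φ, hφ, e⟩ := hR
  let ⟨ψ, hψ, e'⟩ := hS
  ⟨φ ⊓ ψ, hφ.inf hψ, fun v => by rw [holds_inf, e, e']⟩

theorem or (hR : SigRel k R) (hS : SigRel k S) : SigRel k fun v => R v ∨ S v :=
  let ⟨φ, hφ, e⟩ := hR
  let ⟨ψ, hψ, e'⟩ := hS
  ⟨φ ⊔ ψ, hφ.sup hψ, fun v => by rw [holds_sup, e, e']⟩

theorem ex {Q : (Fin n → ℕ) → ℕ → Prop}
    (h : SigRel k fun w : Fin (n + 1) → ℕ => Q (fun i => w i.castSucc) (w (Fin.last n))) :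
    SigRel k fun v => ∃ x, Q v x :=
  let ⟨φ, hφ, e⟩ := h
  ⟨φ.ex, hφ.ex, fun v => by simp only [Holds, realize_ex] at e ⊢; simp [e]⟩

theorem bdall {Q : (Fin n → ℕ) → ℕ → Prop} (hf : IsTermFun f)
    (h : SigRel k fun w : Fin (n + 1) → ℕ => Q (fun i => w i.castSucc) (w (Fin.last n))) :
    SigRel k fun v => ∀ x ≤ f v, Q v x :=
  let ⟨φ, hφ, e⟩ := h
  let ⟨t, ht⟩ := hf
  ⟨_, hφ.bdall t, fun v => by rw [holds_bdall]; simp [e, ht]⟩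

theorem succ (h : SigRel k R) : SigRel (k + 1) R :=
  let ⟨φ, hφ, e⟩ := h
  ⟨φ, hφ.succ, e⟩

theorem not (h : SigRel k R) : SigRel (k + 1) fun v => ¬ R v :=
  let ⟨_, hφ, e⟩ := h
  let ⟨ψ, hψ, e'⟩ := hφ.exists_not
  ⟨ψ, .ofPi hψ, fun v => (e' v).trans (not_congr (e v))⟩

theorem of_delta0 {φ : LA.BoundedFormula Empty n} (h : Delta0 φ) (e : ∀ v, Holds φ v ↔ R v) :
    SigRel k R := by
  refine ⟨φ, .ofPi ?_, e⟩
  clear e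
  induction k with
  | zero => exact .ofDelta0 h
  | succ k ih => exact ih.succ

theorem eq (hf : IsTermFun f) (hg : IsTermFun g) : SigRel k fun v => f v = g v :=
  let ⟨t, ht⟩ := hf
  let ⟨s, hs⟩ := hg
  of_delta0 (.equal t s) fun v => by simp only [Holds, realize_bdEqual]; rw [← ht, ← hs]

theorem le (hf : IsTermFun f) (hg : IsTermFun g) : SigRel k fun v => f v ≤ g v :=
  let ⟨t, ht⟩ := hf
  let ⟨s, hs⟩ := hg
  of_delta0 (.le t s) fun v => by simp only [Holds, realize_leF]; rw [← ht, ← hs]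

theorem lt (hf : IsTermFun f) (hg : IsTermFun g) : SigRel k fun v => f v < g v :=
  le hf.succ hg

end SigRel

open IsTermFun in
theorem sigRel_pair {k n : ℕ} (i j l : Fin n) :
    SigRel k fun v : Fin n → ℕ => v l = Nat.pair (v i) (v j) := by
  refine (((SigRel.lt (proj i) (proj j)).and
    (.eq (proj l) (((proj j).mul (proj j)).add (proj i)))).or
    ((SigRel.le (proj j) (proj i)).and
      (.eq (proj l) ((((proj i).mul (proj i)).add (proj i)).add (proj j))))).congr fun v => ?_
  unfold Nat.pair
  split_ifs with h <;> omega

/-- Gödel's β-function, with its parameters separated. -/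
def betaFun (a b i : ℕ) : ℕ := a % ((i + 1) * b + 1)

open IsTermFun in
theorem sigRel_betaFun {k n : ℕ} (a b i y : Fin n) :
    SigRel k fun v : Fin n → ℕ => betaFun (v a) (v b) (v i) = v y := by
  have hm : IsTermFun fun v : Fin (n + 1) → ℕ =>
      (v i.castSucc + 1) * v b.castSucc + 1 := ((proj _).succ.mul (proj _)).succ
  refine (SigRel.ex (Q := fun v q => v a = q * ((v i + 1) * v b + 1) + v y ∧
    v y < (v i + 1) * v b + 1) ((SigRel.eq (proj _) (((proj _).mul hm).add (proj _))).and
      (.lt (proj _) hm))).congr fun v => ?_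
  rw [betaFun]
  constructor
  · rintro ⟨q, h, h'⟩
    rw [h, Nat.add_comm, Nat.add_mul_mod_self_right, Nat.mod_eq_of_lt h']
  · intro h
    refine ⟨v a / ((v i + 1) * v b + 1), ?_, ?_⟩
    · rw [← h, Nat.mul_comm, Nat.div_add_mod]
    · rw [← h]; exact Nat.mod_lt _ (Nat.succ_pos _)

theorem exists_betaFun (l : List ℕ) : ∃ a b, ∀ i (h : i < l.length), betaFun a b i = l[i] :=
  ⟨(Nat.unbeta l).unpair.1, (Nat.unbeta l).unpair.2, fun i h => Nat.beta_unbeta_coe l ⟨i, h⟩⟩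

theorem sigRel_mem_comp_pair {k n : ℕ} {g : ℕ →. ℕ}
    (hg : SigRel k fun v : Fin 2 → ℕ => v 1 ∈ g (v 0)) (i j y : Fin n) :
    SigRel k fun v : Fin n → ℕ => v y ∈ g (Nat.pair (v i) (v j)) := by
  refine (SigRel.ex (Q := fun v p => p = Nat.pair (v i) (v j) ∧ v y ∈ g p)
    ((sigRel_pair _ _ _).and (hg.rename ![Fin.last n, y.castSucc]))).congr fun v => ?_
  simp

theorem mem_natRec_iff (f : Part ℕ) (g : ℕ → ℕ → Part ℕ) (n z : ℕ) :
    z ∈ (Nat.rec f (fun y IH => IH.bind fun i => g y i) n : Part ℕ) ↔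
      ∃ a b, betaFun a b 0 ∈ f ∧
        (∀ i ≤ n, i = n ∨ betaFun a b (i + 1) ∈ g i (betaFun a b i)) ∧ betaFun a b n = z := by
  constructor
  · intro hz
    obtain ⟨l, hl, h0, hs, hn⟩ : ∃ l : List ℕ, l.length = n + 1 ∧ (∀ h : 0 < l.length, l[0] ∈ f) ∧
        (∀ i (h : i + 1 < l.length), l[i + 1] ∈ g i l[i]) ∧
        ∀ h : n < l.length, l[n] = z := by
      induction n generalizing z with
      | zero => exact ⟨[z], rfl, fun _ => hz, by simp, by simp⟩
      | succ n ih =>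
        obtain ⟨i, hi, hz⟩ := Part.mem_bind_iff.1 hz
        obtain ⟨l, hl, h0, hs, hn⟩ := ih i hi
        refine ⟨l ++ [z], by simp [hl], fun h => ?_, fun j h => ?_, by simp [← hl]⟩
        · rw [List.getElem_append_left (by omega)]; exact h0 _
        · rw [List.getElem_append_left (by simp at h; omega)]
          rcases Nat.lt_or_ge (j + 1) l.length with h' | h'
          · rw [List.getElem_append_left h']; exact hs j h'
          · have : j = n := by simp at h; omega
            subst this
            rw [List.getElem_append_right h', hn (by omega)]
            simpa using hz
    obtain ⟨a, b, h⟩ := exists_betaFun l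
    refine ⟨a, b, ?_, fun i hi => ?_, ?_⟩
    · rw [h 0 (by omega)]; exact h0 _
    · rcases hi.eq_or_lt with hi | hi
      · exact .inl hi
      · rw [h i (by omega), h (i + 1) (by omega)]; exact .inr (hs i (by omega))
    · rw [h n (by omega)]; exact hn _
  · rintro ⟨a, b, h0, hs, rfl⟩
    suffices ∀ i ≤ n, betaFun a b i ∈
        (Nat.rec f (fun y IH => IH.bind fun i => g y i) i : Part ℕ) from this n le_rfl
    intro i hi
    induction i with
    | zero => exact h0
    | succ i ih =>
      exact Part.mem_bind_iff.2 ⟨_, ih (by omega), (hs i (by omega)).resolve_left (by omega)⟩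

open IsTermFun in
/-- The graph of a partial recursive function is `Σ₁`. -/
theorem sigRel_graph {f : ℕ →. ℕ} (hf : Nat.Partrec f) {k : ℕ} :
    SigRel k fun v : Fin 2 → ℕ => v 1 ∈ f (v 0) := by
  induction hf with
  | zero => exact (SigRel.eq (proj 1) zero).congr fun v => by simp [pure, PFun.pure]
  | succ => exact (SigRel.eq (proj 1) (proj 0).succ).congr fun v => by simp
  | left =>
    refine (SigRel.ex (Q := fun v y => v 0 = Nat.pair (v 1) y) (sigRel_pair 1 2 0)).congr
      fun v => ?_
    simp only [PFun.coe_val, Part.mem_some_iff]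
    exact ⟨fun ⟨y, h⟩ => by simp [h], fun h => ⟨(v 0).unpair.2, by simp [h]⟩⟩
  | right =>
    refine (SigRel.ex (Q := fun v y => v 0 = Nat.pair y (v 1)) (sigRel_pair 2 1 0)).congr
      fun v => ?_
    simp only [PFun.coe_val, Part.mem_some_iff]
    exact ⟨fun ⟨y, h⟩ => by simp [h], fun h => ⟨(v 0).unpair.1, by simp [h]⟩⟩
  | @pair f g _ _ ihf ihg =>
    refine (SigRel.ex (Q := fun v x => ∃ y, x ∈ f (v 0) ∧ y ∈ g (v 0) ∧ v 1 = Nat.pair x y)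
      (SigRel.ex (Q := fun v y => v 2 ∈ f (v 0) ∧ y ∈ g (v 0) ∧ v 1 = Nat.pair (v 2) y)
        ((ihf.rename ![0, 2]).and ((ihg.rename ![0, 3]).and (sigRel_pair 2 3 1))))).congr
      fun v => ?_
    simp [Seq.seq, eq_comm]
  | @comp f g _ _ ihf ihg =>
    refine (SigRel.ex (Q := fun v x => x ∈ g (v 0) ∧ v 1 ∈ f x)
      ((ihg.rename ![0, 2]).and (ihf.rename ![2, 1]))).congr fun v => ?_
    exact Part.mem_bind_iff.symm
  | @prec f g _ _ ihf ihg =>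
    have step : SigRel k fun v : Fin 7 → ℕ =>
        v 6 = v 3 ∨ betaFun (v 4) (v 5) (v 6 + 1) ∈
          g (Nat.pair (v 2) (Nat.pair (v 6) (betaFun (v 4) (v 5) (v 6)))) := by
      refine (SigRel.eq (proj 6) (proj 3)).or ((SigRel.ex (Q := fun v x => ∃ j y p,
        betaFun (v 4) (v 5) (v 6) = x ∧ j = v 6 + 1 ∧ betaFun (v 4) (v 5) j = y ∧
        p = Nat.pair (v 6) x ∧ y ∈ g (Nat.pair (v 2) p)) (.ex (.ex (.ex ?_)))).congr fun v => ?_)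
      · exact (sigRel_betaFun 4 5 6 7).and ((SigRel.eq (proj 8) (proj 6).succ).and
          ((sigRel_betaFun 4 5 8 9).and ((sigRel_pair 6 7 10).and
            (sigRel_mem_comp_pair ihg 2 10 9))))
      · simp
    have main : SigRel k fun v : Fin 2 → ℕ => ∃ x n a b, v 0 = Nat.pair x n ∧
        betaFun a b 0 ∈ f x ∧ (∀ i ≤ n, i = n ∨ betaFun a b (i + 1) ∈
          g (Nat.pair x (Nat.pair i (betaFun a b i)))) ∧ betaFun a b n = v 1 := by
      refine .ex (.ex (.ex (.ex ?_)))
      refine (sigRel_pair (n := 6) 2 3 0).and (SigRel.and ?_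
        ((SigRel.bdall (proj 3) step).and (sigRel_betaFun 4 5 3 1)))
      refine (SigRel.ex (Q := fun v x => ∃ y, x = 0 ∧ betaFun (v 4) (v 5) x = y ∧ y ∈ f (v 2))
        (.ex ((SigRel.eq (proj 6) zero).and ((sigRel_betaFun 4 5 6 7).and
          (ihf.rename ![2, 7]))))).congr fun v => ?_
      simp only [exists_and_left, exists_eq_left, exists_eq_left']
      rfl
    refine main.congr fun v => ?_
    have := fun x n z => mem_natRec_iff (f x) (fun y i => g (Nat.pair x (Nat.pair y i))) n z
    simp only [Nat.unpaired, Part.bind_eq_bind, this]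
    constructor
    · rintro ⟨x, n, a, b, h, h'⟩
      exact ⟨a, b, by simpa [h] using h'⟩
    · rintro ⟨a, b, h⟩
      exact ⟨_, _, a, b, (Nat.pair_unpair _).symm, h⟩
  | @rfind f _ ihf =>
    have zero_mem : SigRel k fun v : Fin 2 → ℕ => 0 ∈ f (Nat.pair (v 0) (v 1)) :=
      (SigRel.ex (Q := fun v x => x = 0 ∧ x ∈ f (Nat.pair (v 0) (v 1)))
        ((SigRel.eq (proj 2) zero).and (sigRel_mem_comp_pair ihf 0 1 2))).congr fun v => by simp
    have step : SigRel k fun v : Fin 3 → ℕ => v 2 = v 1 ∨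
        ∃ y, y ∈ f (Nat.pair (v 0) (v 2)) ∧ 0 < y :=
      (SigRel.eq (proj 2) (proj 1)).or (.ex ((sigRel_mem_comp_pair ihf 0 2 3).and
        (.lt zero (proj 3))))
    refine (zero_mem.and (SigRel.bdall (Q := fun v m => m = v 1 ∨
        ∃ y, y ∈ f (Nat.pair (v 0) m) ∧ 0 < y) (proj 1) step)).congr fun v => ?_
    refine Iff.trans ?_ Nat.mem_rfind.symm
    simp only [Part.map_eq_map, Part.mem_map_iff]
    constructor
    · rintro ⟨h0, h⟩
      refine ⟨⟨0, h0, by simp⟩, fun {m} hm => ?_⟩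
      obtain h | ⟨y, hy, h⟩ := h m hm.le
      · exact absurd h hm.ne
      · exact ⟨y, hy, by simpa using h.ne'⟩
    · rintro ⟨⟨y, hy, h⟩, h'⟩
      obtain rfl : y = 0 := by simpa using h
      refine ⟨hy, fun m hm => ?_⟩
      rcases hm.eq_or_lt with e | hm
      · exact .inl e
      · obtain ⟨y, hy, h⟩ := h' hm
        exact .inr ⟨y, hy, Nat.pos_of_ne_zero (by simpa using h)⟩

/-! ### Primitive recursive functions -/

attribute [fun_prop] Primrec
attribute [fun_prop] Primrec.id Primrec.const Primrec.comp Primrec.fst Primrec.snd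

section Primrec

variable {α β γ : Type} [Primcodable α] [Primcodable β] [Primcodable γ]

@[fun_prop] theorem primrec_prodMk {f : α → β} {g : α → γ} (hf : Primrec f) (hg : Primrec g) :
    Primrec fun a => (f a, g a) := hf.pair hg

@[fun_prop] theorem primrec_cons {f : α → β} {g : α → List β} (hf : Primrec f) (hg : Primrec g) :
    Primrec fun a => f a :: g a := Primrec.list_cons.comp hf hg

@[fun_prop] theorem primrec_append {f g : α → List β} (hf : Primrec f) (hg : Primrec g) :
    Primrec fun a => f a ++ g a := Primrec.list_append.comp hf hg

@[fun_prop] theorem primrec_length {f : α → List β} (hf : Primrec f) :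
    Primrec fun a => (f a).length := Primrec.list_length.comp hf

@[fun_prop] theorem primrec_getElem? {f : α → List β} {g : α → ℕ} (hf : Primrec f)
    (hg : Primrec g) : Primrec fun a => (f a)[g a]? := Primrec.list_getElem?.comp hf hg

@[fun_prop] theorem primrec_reverse {f : α → List β} (hf : Primrec f) :
    Primrec fun a => (f a).reverse := Primrec.list_reverse.comp hf

@[fun_prop] theorem primrec_range {f : α → ℕ} (hf : Primrec f) :
    Primrec fun a => List.range (f a) := Primrec.list_range.comp hf

@[fun_prop] theorem primrec_some {f : α → β} (hf : Primrec f) :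
    Primrec fun a => some (f a) := Primrec.option_some.comp hf

@[fun_prop] theorem primrec_encode {f : α → β} (hf : Primrec f) :
    Primrec fun a => Encodable.encode (f a) := Primrec.encode.comp hf

@[fun_prop] theorem primrec_add {f g : α → ℕ} (hf : Primrec f) (hg : Primrec g) :
    Primrec fun a => f a + g a := Primrec.nat_add.comp hf hg

@[fun_prop] theorem primrec_mul {f g : α → ℕ} (hf : Primrec f) (hg : Primrec g) :
    Primrec fun a => f a * g a := Primrec.nat_mul.comp hf hg

@[fun_prop] theorem primrec_pair {f g : α → ℕ} (hf : Primrec f) (hg : Primrec g) :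
    Primrec fun a => Nat.pair (f a) (g a) := Primrec₂.natPair.comp hf hg

@[fun_prop] theorem primrec_not {f : α → Bool} (hf : Primrec f) :
    Primrec fun a => !f a := Primrec.not.comp hf

theorem primrec_map {f : α → List β} {g : α → β → γ} (hf : Primrec f)
    (hg : Primrec fun x : α × β => g x.1 x.2) : Primrec fun a => (f a).map (g a) :=
  Primrec.list_map hf hg.to₂

end Primrec

/-! ### Definability of predicates on encodable types -/

/-- The predicate `p`, read through the encoding of `α`, is `Σ_{k+1}`-definable. -/
def Sig (k : ℕ) {α : Type} [Primcodable α] (p : α → Prop) : Prop :=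
  ∃ A : ℕ → Prop, SigRel k (fun v : Fin 1 → ℕ => A (v 0)) ∧ ∀ a, p a ↔ A (Encodable.encode a)

namespace Sig

open Encodable

variable {α β : Type} [Primcodable α] [Primcodable β] {k : ℕ} {p q : α → Prop}

theorem congr (h : Sig k p) (e : ∀ a, p a ↔ q a) : Sig k q :=
  let ⟨A, hA, hp⟩ := h
  ⟨A, hA, fun a => (e a).symm.trans (hp a)⟩

theorem succ (h : Sig k p) : Sig (k + 1) p :=
  let ⟨A, hA, hp⟩ := h
  ⟨A, hA.succ, hp⟩

theorem not (h : Sig k p) : Sig (k + 1) fun a => ¬ p a :=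
  let ⟨A, hA, hp⟩ := h
  ⟨fun n => ¬ A n, hA.not, fun a => not_congr (hp a)⟩

theorem and (hp : Sig k p) (hq : Sig k q) : Sig k fun a => p a ∧ q a :=
  let ⟨A, hA, hp⟩ := hp
  let ⟨B, hB, hq⟩ := hq
  ⟨fun n => A n ∧ B n, hA.and hB, fun a => and_congr (hp a) (hq a)⟩

theorem or (hp : Sig k p) (hq : Sig k q) : Sig k fun a => p a ∨ q a :=
  let ⟨A, hA, hp⟩ := hp
  let ⟨B, hB, hq⟩ := hq
  ⟨fun n => A n ∨ B n, hA.or hB, fun a => or_congr (hp a) (hq a)⟩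

theorem comp {p : β → Prop} (h : Sig k p) {f : α → β} (hf : Primrec f) :
    Sig k fun a => p (f a) := by
  obtain ⟨A, hA, hp⟩ := h
  refine ⟨fun n => ∃ m,
    m ∈ ((decode (α := α) n : Part α).bind fun a => (Part.some (f a)).map encode)
    ∧ A m, SigRel.ex ((sigRel_graph hf.to_comp).and (hA.rename ![1])), fun a => ?_⟩
  simp [hp]

theorem of_rePred (h : REPred p) : Sig k p := by
  refine ⟨fun n => ∃ m, m ∈ ((decode (α := α) n : Part α).bind fun a =>
    (Part.assert (p a) fun _ => Part.some ()).map encode), SigRel.ex (sigRel_graph h), fun a => ?_⟩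
  simp

theorem of_primrecPred (h : PrimrecPred p) : Sig k p := of_rePred h.computablePred.to_re

theorem eq {f g : α → β} (hf : Primrec f) (hg : Primrec g) : Sig k fun a => f a = g a := by
  classical
  exact of_primrecPred (Primrec.eq.comp hf hg)

theorem lt {f g : α → ℕ} (hf : Primrec f) (hg : Primrec g) : Sig k fun a => f a < g a :=
  of_primrecPred (Primrec.nat_lt.comp hf hg)

theorem le {f g : α → ℕ} (hf : Primrec f) (hg : Primrec g) : Sig k fun a => f a ≤ g a :=
  of_primrecPred (Primrec.nat_le.comp hf hg)

theorem ex {p : α → β → Prop} (h : Sig k fun x : α × β => p x.1 x.2) :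
    Sig k fun a => ∃ b, p a b := by
  obtain ⟨A, hA, hp⟩ := h
  have hp' : ∀ a b, p a b ↔ A (Nat.pair (encode a) (encode b)) := fun a b => hp (a, b)
  have hg := sigRel_graph (k := k) (Nat.Partrec.of_primrec (Primcodable.prim (α := β)))
  refine ⟨fun n => ∃ y z m c, z = encode (decode (α := β) y) ∧ z = m + 1 ∧ c = Nat.pair n m ∧ A c,
    .ex (.ex (.ex (.ex ?_))), fun a => ?_⟩
  · refine SigRel.and ((hg.rename ![1, 2]).congr fun v => ?_)
      ((SigRel.eq (.proj 2) (.succ (.proj 3))).and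
        ((sigRel_pair 0 3 4).and (hA.rename ![4])))
    simp only [PFun.coe_val, Part.mem_some_iff]
    rfl
  · simp only [hp']
    constructor
    · rintro ⟨b, h⟩
      exact ⟨encode b, _, _, _, rfl, by simp, rfl, h⟩
    · rintro ⟨y, _, m, _, rfl, h, rfl, hA⟩
      cases hd : decode (α := β) y with
      | none => simp [hd] at h
      | some b => exact ⟨b, by obtain rfl : encode b = m := by simpa [hd] using h
                               exact hA⟩

theorem ball_lt {p : α → ℕ → Prop} {f : α → ℕ} (hf : Primrec f)
    (h : Sig k fun x : α × ℕ => p x.1 x.2) : Sig k fun a => ∀ i < f a, p a i := by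
  obtain ⟨A, hA, hp⟩ := h
  have hp' : ∀ a b, p a b ↔ A (Nat.pair (encode a) b) := fun a b => hp (a, b)
  have hA' : SigRel k fun v : Fin 3 → ℕ => v 2 = v 1 ∨ A (Nat.pair (v 0) (v 2)) :=
    (SigRel.eq (.proj 2) (.proj 1)).or ((SigRel.ex (Q := fun v c => c = Nat.pair (v 0) (v 2) ∧ A c)
      ((sigRel_pair 0 2 3).and (hA.rename ![3]))).congr fun v => by simp)
  refine ⟨fun n => ∃ m,
    m ∈ ((decode (α := α) n : Part α).bind fun a => (Part.some (f a)).map encode)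
    ∧ ∀ i ≤ m, i = m ∨ A (Nat.pair n i), SigRel.ex ((sigRel_graph hf.to_comp).and
      (SigRel.bdall (Q := fun v i => i = v 1 ∨ A (Nat.pair (v 0) i)) (.proj 1) hA')), fun a => ?_⟩
  simp only [hp', encodek, Part.coe_some, Part.bind_some, Part.map_some, Part.mem_some_iff,
    exists_eq_left, encode_nat]
  exact ⟨fun h i hi => hi.eq_or_lt.imp_right (h i),
    fun h i hi => (h i hi.le).resolve_left hi.ne⟩

theorem ball_mem {p : α → β → Prop} {f : α → List β} (hf : Primrec f)
    (h : Sig k fun x : α × β => p x.1 x.2) : Sig k fun a => ∀ b ∈ f a, p a b := by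
  refine (ball_lt (p := fun a i => ∃ b, (f a)[i]? = some b ∧ p a b) (f := fun a => (f a).length)
    (by fun_prop) (ex ((eq ?_ ?_).and
      (h.comp (f := fun x : (α × ℕ) × β => (x.1.1, x.2)) ?_)))).congr fun a => ?_
  any_goals fun_prop
  constructor
  · intro h b hb
    obtain ⟨i, hi, rfl⟩ := List.getElem_of_mem hb
    obtain ⟨b, hb, h⟩ := h i hi
    rw [List.getElem?_eq_getElem hi, Option.some_inj] at hb
    exact hb ▸ h
  · exact fun h i hi => ⟨(f a)[i], List.getElem?_eq_getElem hi, h _ (List.getElem_mem hi)⟩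

theorem mem {f : α → List β} {g : α → β} (hf : Primrec f) (hg : Primrec g) :
    Sig k fun a => g a ∈ f a := by
  refine (ex (β := ℕ) (p := fun a i => (f a)[i]? = some (g a)) (eq ?_ ?_)).congr fun a => ?_
  · fun_prop
  · fun_prop
  · rw [List.mem_iff_getElem?]

theorem false : Sig k fun _ : α => False :=
  (eq (β := ℕ) (Primrec.const 0) (Primrec.const 1)).congr fun _ => by simp

end Sig

/-! ### Derivability -/

/-- Derivability by means of the inference rules `rule`. -/
inductive Der {α : Type} (rule : List α → α → Prop) : α → Prop
  | mk (ps : List α) (x : α) : (∀ y ∈ ps, Der rule y) → rule ps x → Der rule x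

/-- Every entry of the list follows by `rule` from entries that come after it. -/
def IsDerivation {α : Type} (rule : List α → α → Prop) : List α → Prop
  | [] => True
  | x :: l => (∃ ps, ps ⊆ l ∧ rule ps x) ∧ IsDerivation rule l

section Der

variable {α : Type} {rule : List α → α → Prop}

theorem IsDerivation.append : ∀ {l m : List α}, IsDerivation rule l → IsDerivation rule m →
    IsDerivation rule (l ++ m)
  | [], _, _, hm => hm
  | _ :: _, _, ⟨⟨ps, hps, h⟩, hl⟩, hm =>
    ⟨⟨ps, List.subset_append_of_subset_left _ hps, h⟩, hl.append hm⟩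

theorem IsDerivation.der : ∀ {l : List α}, IsDerivation rule l → ∀ x ∈ l, Der rule x
  | [], _, _, hx => by simp at hx
  | y :: l, ⟨⟨ps, hps, h⟩, hl⟩, x, hx => by
    rcases List.mem_cons.1 hx with rfl | hx
    · exact .mk ps _ (fun z hz => hl.der z (hps hz)) h
    · exact hl.der x hx

theorem Der.exists_isDerivation {x : α} (h : Der rule x) :
    ∃ l, IsDerivation rule l ∧ x ∈ l := by
  induction h with
  | mk ps x _ hr ih =>
    have : ∃ l, IsDerivation rule l ∧ ps ⊆ l := by
      clear hr
      induction ps with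
      | nil => exact ⟨[], trivial, List.nil_subset _⟩
      | cons y ps ihps =>
        obtain ⟨l, hl, hy⟩ := ih y (by simp)
        obtain ⟨m, hm, hps⟩ := ihps (fun z hz => by simp_all) fun z hz => ih z (by simp [hz])
        exact ⟨l ++ m, hl.append hm, by simp_all [List.subset_def]⟩
    obtain ⟨l, hl, hps⟩ := this
    exact ⟨x :: l, ⟨⟨ps, hps, hr⟩, hl⟩, by simp⟩

theorem isDerivation_iff : ∀ {l : List α}, IsDerivation rule l ↔ ∀ i < l.length,
    ∃ ps y, l[i]? = some y ∧ rule ps y ∧ ∀ z ∈ ps, ∃ j, i < j ∧ l[j]? = some z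
  | [] => by simp [IsDerivation]
  | x :: l => by
    rw [IsDerivation, isDerivation_iff]
    constructor
    · rintro ⟨⟨ps, hps, h⟩, hl⟩ (_ | i) hi
      · refine ⟨ps, x, rfl, h, fun z hz => ?_⟩
        obtain ⟨j, hj⟩ := List.mem_iff_getElem?.1 (hps hz)
        exact ⟨j + 1, by omega, hj⟩
      · obtain ⟨ps, y, hy, h, hz⟩ := hl i (by simpa using hi)
        refine ⟨ps, y, hy, h, fun z hz' => ?_⟩
        obtain ⟨j, hj, e⟩ := hz z hz'
        exact ⟨j + 1, by omega, e⟩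
    · intro H
      constructor
      · obtain ⟨ps, y, hy, h, hz⟩ := H 0 (by simp)
        obtain rfl : x = y := by simpa using hy
        refine ⟨ps, fun z hz' => ?_, h⟩
        obtain ⟨_ | j, hj, e⟩ := hz z hz'
        · omega
        · exact List.mem_iff_getElem?.2 ⟨j, e⟩
      · intro i hi
        obtain ⟨ps, y, hy, h, hz⟩ := H (i + 1) (by simpa using hi)
        refine ⟨ps, y, hy, h, fun z hz' => ?_⟩
        obtain ⟨_ | j, hj, e⟩ := hz z hz'
        · omega
        · exact ⟨j, by omega, e⟩

theorem Sig.der [Primcodable α] {k : ℕ} (h : Sig k fun x : List α × α => rule x.1 x.2) :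
    Sig k (Der rule) := by
  refine (Sig.ex (β := List α) (p := fun x l => (∀ i < l.length, ∃ ps y, l[i]? = some y ∧
    rule ps y ∧ ∀ z ∈ ps, ∃ j, i < j ∧ l[j]? = some z) ∧ x ∈ l) ?_).congr fun x => ?_
  · refine Sig.and (Sig.ball_lt ?_ (.ex (.ex ((Sig.eq ?_ ?_).and
      ((h.comp (f := fun x : (((α × List α) × ℕ) × List α) × α => (x.1.2, x.2)) ?_).and
        (.ball_mem ?_ (.ex ((Sig.lt ?_ ?_).and (.eq ?_ ?_))))))))) (.mem ?_ ?_) <;> fun_prop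
  · simp only [← isDerivation_iff]
    exact ⟨fun ⟨_, hl, hx⟩ => hl.der x hx, fun h => h.exists_isDerivation⟩

end Der

open Encodable

/-! ### Codes of terms and formulas -/

theorem encode_map_encode {α : Type} [Encodable α] (l : List α) :
    encode (l.map encode) = encode l := by
  induction l with
  | nil => rfl
  | cons a l ih => simp [ih]

/-- The code of a term, as a list of numbers. -/
def termCode {k : ℕ} (t : LA.Term (Empty ⊕ Fin k)) : List ℕ := t.listEncode.map encode

/-- The code of a formula, as a list of numbers. -/
def formCode {k : ℕ} (φ : LA.BoundedFormula Empty k) : List ℕ := φ.listEncode.map encode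

theorem godel_eq {k : ℕ} (φ : LA.BoundedFormula Empty k) : godel φ = encode (formCode φ) :=
  (encode_map_encode _).symm

theorem encode_term {k : ℕ} (t : LA.Term (Empty ⊕ Fin k)) : encode t = encode (termCode t) :=
  (encode_map_encode t.listEncode).symm

section Code

variable {k : ℕ}

@[simp] theorem termCode_var (i : Fin k) :
    termCode (Term.var (Sum.inr i)) = [2 * (2 * (i : ℕ) + 1)] := rfl

@[simp] theorem termCode_zeroT : termCode (zeroT : LA.Term (Empty ⊕ Fin k)) = [1] := rfl

@[simp] theorem termCode_succT (t : LA.Term (Empty ⊕ Fin k)) :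
    termCode (succT t) = 3 :: termCode t := by
  simp [termCode, succT, Term.listEncode, List.finRange]
  rfl

@[simp] theorem termCode_addT (t s : LA.Term (Empty ⊕ Fin k)) :
    termCode (addT t s) = 5 :: (termCode t ++ termCode s) := by
  simp [termCode, addT, Term.listEncode, List.finRange]
  rfl

@[simp] theorem termCode_mulT (t s : LA.Term (Empty ⊕ Fin k)) :
    termCode (mulT t s) = 7 :: (termCode t ++ termCode s) := by
  simp [termCode, mulT, Term.listEncode, List.finRange]
  rfl

/-- Structural induction on arithmetical terms. -/
@[elab_as_elim] theorem term_induction {α : Type} {P : LA.Term α → Prop} (var : ∀ a, P (.var a))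
    (zero : P zeroT) (succ : ∀ t, P t → P (succT t)) (add : ∀ t s, P t → P s → P (addT t s))
    (mul : ∀ t s, P t → P s → P (mulT t s)) (t : LA.Term α) : P t := by
  induction t with
  | var a => exact var a
  | func f ts ih =>
    cases f with
    | zero => rw [Subsingleton.elim ts ![] ]; exact zero
    | succ =>
      rw [show ts = ![ts 0] from funext fun i => by fin_cases i; rfl]; exact succ _ (ih 0)
    | add =>
      rw [show ts = ![ts 0, ts 1] from funext fun i => by fin_cases i <;> rfl]
      exact add _ _ (ih 0) (ih 1)
    | mul =>
      rw [show ts = ![ts 0, ts 1] from funext fun i => by fin_cases i <;> rfl]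
      exact mul _ _ (ih 0) (ih 1)

/-- Structural induction on arithmetical formulas. -/
@[elab_as_elim] theorem formula_induction
    {P : ∀ k : ℕ, LA.BoundedFormula Empty k → Prop} (falsum : ∀ k, P k ⊥)
    (equal : ∀ k t s, P k (t =' s)) (le : ∀ k t s, P k (leF t s))
    (imp : ∀ k φ ψ, P k φ → P k ψ → P k (φ ⟹ ψ)) (all : ∀ k φ, P (k + 1) φ → P k φ.all)
    {k : ℕ} (φ : LA.BoundedFormula Empty k) : P k φ := by
  induction φ with
  | falsum => exact falsum _
  | equal t s => exact equal _ t s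
  | rel R ts =>
    cases R with
    | le =>
      rw [show ts = ![ts 0, ts 1] from funext fun i => by fin_cases i <;> rfl]
      exact le _ _ _
  | imp _ _ ih₁ ih₂ => exact imp _ _ _ ih₁ ih₂
  | all _ ih => exact all _ _ ih

@[simp] theorem liftT_var (i : Fin k) :
    liftT (Term.var (Sum.inr i)) = Term.var (Sum.inr i.castSucc) := rfl

theorem liftT_zeroT : liftT (zeroT : LA.Term (Empty ⊕ Fin k)) = zeroT :=
  congrArg (Term.func (L := LA) (l := 0) ArithFunc.zero) (Subsingleton.elim _ _)

theorem liftT_succT (t : LA.Term (Empty ⊕ Fin k)) : liftT (succT t) = succT (liftT t) :=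
  congrArg (Term.func (L := LA) (l := 1) ArithFunc.succ) (funext fun i => by fin_cases i; rfl)

theorem liftT_addT (t s : LA.Term (Empty ⊕ Fin k)) :
    liftT (addT t s) = addT (liftT t) (liftT s) :=
  congrArg (Term.func (L := LA) (l := 2) ArithFunc.add) (funext fun i => by fin_cases i <;> rfl)

theorem liftT_mulT (t s : LA.Term (Empty ⊕ Fin k)) :
    liftT (mulT t s) = mulT (liftT t) (liftT s) :=
  congrArg (Term.func (L := LA) (l := 2) ArithFunc.mul) (funext fun i => by fin_cases i <;> rfl)

@[simp] theorem termCode_liftT (t : LA.Term (Empty ⊕ Fin k)) :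
    termCode (liftT t) = termCode t := by
  induction t using term_induction with
  | var a => rcases a with a | i
             · exact a.elim
             · simp
  | zero => simp [liftT_zeroT]
  | succ t ih => simp [liftT_succT, ih]
  | add t s iht ihs => simp [liftT_addT, iht, ihs]
  | mul t s iht ihs => simp [liftT_mulT, iht, ihs]

/-- The code of `⊥` in context `k`. -/
def botCode (k : ℕ) : List ℕ := [4 * (k + 2) + 3]

/-- The code of an equation between the terms coded by `l` and `m` in context `k`. -/
def eqCode (k : ℕ) (l m : List ℕ) : List ℕ :=
  [2 * Nat.pair k (encode l), 2 * Nat.pair k (encode m)]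

/-- The code of an inequality between the terms coded by `l` and `m` in context `k`. -/
def leCode (k : ℕ) (l m : List ℕ) : List ℕ :=
  1 :: (4 * k + 3) :: eqCode k l m

/-- The code of an implication. -/
def impCode (l m : List ℕ) : List ℕ := 3 :: (l ++ m)

/-- The code of a universal quantification. -/
def allCode (l : List ℕ) : List ℕ := 7 :: l

/-- The code of `∀ x ≤ t, φ`, where `t` is coded by `l` in context `k` and `φ` by `m`. -/
def ballCode (k : ℕ) (l m : List ℕ) : List ℕ :=
  allCode (impCode (leCode (k + 1) [2 * (2 * k + 1)] l) m)

/-- The code of `∀ x ≤ t, φ` with the scope of the quantifier doubly negated. -/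
def ballNotNotCode (k : ℕ) (l m : List ℕ) : List ℕ :=
  allCode (impCode (impCode (impCode (leCode (k + 1) [2 * (2 * k + 1)] l) m)
    (botCode (k + 1))) (botCode (k + 1)))

@[simp] theorem formCode_bot : formCode (⊥ : LA.BoundedFormula Empty k) = botCode k := by
  simp [formCode, botCode, BoundedFormula.listEncode]
  omega

@[simp] theorem formCode_eq (t s : LA.Term (Empty ⊕ Fin k)) :
    formCode (t =' s) = eqCode k (termCode t) (termCode s) := by
  simp [formCode, eqCode, Term.bdEqual, BoundedFormula.listEncode, encode_term]

@[simp] theorem formCode_leF (t s : LA.Term (Empty ⊕ Fin k)) :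
    formCode (leF t s) = leCode k (termCode t) (termCode s) := by
  simp [formCode, leCode, eqCode, leF, BoundedFormula.listEncode, List.finRange, encode_term]
  exact ⟨rfl, by omega⟩

@[simp] theorem formCode_imp (φ ψ : LA.BoundedFormula Empty k) :
    formCode (φ ⟹ ψ) = impCode (formCode φ) (formCode ψ) := by
  simp [formCode, impCode, BoundedFormula.listEncode]

@[simp] theorem formCode_all (φ : LA.BoundedFormula Empty (k + 1)) :
    formCode φ.all = allCode (formCode φ) := by
  simp [formCode, allCode, BoundedFormula.listEncode]

theorem formCode_ball (t : LA.Term (Empty ⊕ Fin k)) (φ : LA.BoundedFormula Empty (k + 1)) :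
    formCode (leF (&(Fin.last k)) (liftT t) ⟹ φ).all = ballCode k (termCode t) (formCode φ) := by
  simp [ballCode]

theorem formCode_ballNotNot (t : LA.Term (Empty ⊕ Fin k)) (φ : LA.BoundedFormula Empty (k + 1)) :
    formCode (∼∼(leF (&(Fin.last k)) (liftT t) ⟹ φ)).all =
      ballNotNotCode k (termCode t) (formCode φ) := by
  simp [ballNotNotCode, BoundedFormula.not]

theorem formCode_injective : Function.Injective (formCode (k := k)) := by
  intro φ ψ h
  have h' : φ.listEncode = ψ.listEncode := List.map_injective_iff.2 encode_injective h
  have := @BoundedFormula.listEncode_sigma_injective LA Empty ⟨k, φ⟩ ⟨k, ψ⟩ h'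
  simpa using this

end Code

section Primrec

variable {α : Type} [Primcodable α] {f : α → ℕ} {g h : α → List ℕ}

@[fun_prop] theorem primrec_botCode (hf : Primrec f) : Primrec fun a => botCode (f a) := by
  unfold botCode; fun_prop

@[fun_prop] theorem primrec_eqCode (hf : Primrec f) (hg : Primrec g) (hh : Primrec h) :
    Primrec fun a => eqCode (f a) (g a) (h a) := by
  unfold eqCode; fun_prop

@[fun_prop] theorem primrec_leCode (hf : Primrec f) (hg : Primrec g) (hh : Primrec h) :
    Primrec fun a => leCode (f a) (g a) (h a) := by
  unfold leCode; fun_prop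

@[fun_prop] theorem primrec_impCode (hg : Primrec g) (hh : Primrec h) :
    Primrec fun a => impCode (g a) (h a) := by
  unfold impCode; fun_prop

@[fun_prop] theorem primrec_allCode (hg : Primrec g) : Primrec fun a => allCode (g a) := by
  unfold allCode; fun_prop

@[fun_prop] theorem primrec_ballCode (hf : Primrec f) (hg : Primrec g) (hh : Primrec h) :
    Primrec fun a => ballCode (f a) (g a) (h a) := by
  unfold ballCode; fun_prop

@[fun_prop] theorem primrec_ballNotNotCode (hf : Primrec f) (hg : Primrec g) (hh : Primrec h) :
    Primrec fun a => ballNotNotCode (f a) (g a) (h a) := by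
  unfold ballNotNotCode; fun_prop

end Primrec

/-! ### Environments and values of coded terms -/

/-- The assignment given by an environment, whose last variable comes first. -/
def val : (e : List ℕ) → Fin e.length → ℕ
  | [] => Fin.elim0
  | x :: e => (Fin.snoc (val e) x : Fin (e.length + 1) → ℕ)

theorem getElem?_reverse_val : ∀ (e : List ℕ) (i : Fin e.length),
    e.reverse[(i : ℕ)]? = some (val e i)
  | [], i => i.elim0
  | x :: e, i => by
    refine Fin.lastCases (n := e.length) ?_ (fun j => ?_) i
    · simp [val]
    · simpa [val, List.getElem?_append] using getElem?_reverse_val e j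

/-- An interpretation on `ℕ` of the function symbols of arithmetic. -/
structure TermAlg where
  /-- The interpretation of `0`. -/
  zero : ℕ
  /-- The interpretation of `S`. -/
  succ : ℕ → ℕ
  /-- The interpretation of `+`. -/
  add : ℕ → ℕ → ℕ
  /-- The interpretation of `×`. -/
  mul : ℕ → ℕ → ℕ

namespace TermAlg

/-- The value of a term. -/
def eval (A : TermAlg) {k : ℕ} (v : Fin k → ℕ) : LA.Term (Empty ⊕ Fin k) → ℕ
  | .var (.inl a) => a.elim
  | .var (.inr i) => v i
  | .func ArithFunc.zero _ => A.zero
  | .func ArithFunc.succ ts => A.succ (eval A v (ts 0))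
  | .func ArithFunc.add ts => A.add (eval A v (ts 0)) (eval A v (ts 1))
  | .func ArithFunc.mul ts => A.mul (eval A v (ts 0)) (eval A v (ts 1))

/-- The term coded by `l` takes the value `y` in the environment `e`. -/
def HasValue (A : TermAlg) (l e : List ℕ) (y : ℕ) : Prop :=
  ∃ t : LA.Term (Empty ⊕ Fin e.length), termCode t = l ∧ A.eval (val e) t = y

variable (A : TermAlg)

/-- The rules that compute the values of coded terms. -/
def valueRule (ps : List (List ℕ × List ℕ × ℕ)) (x : List ℕ × List ℕ × ℕ) : Prop :=
  (∃ e i y, e.reverse[i]? = some y ∧ ps = [] ∧ x = ([2 * (2 * i + 1)], e, y)) ∨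
  (∃ e, ps = [] ∧ x = ([1], e, A.zero)) ∨
  (∃ e l y, ps = [(l, e, y)] ∧ x = (3 :: l, e, A.succ y)) ∨
  (∃ e l y m z, ps = [(l, e, y), (m, e, z)] ∧ x = (5 :: (l ++ m), e, A.add y z)) ∨
  (∃ e l y m z, ps = [(l, e, y), (m, e, z)] ∧ x = (7 :: (l ++ m), e, A.mul y z))

theorem hasValue_iff (l e : List ℕ) (y : ℕ) : A.HasValue l e y ↔ Der A.valueRule (l, e, y) := by
  constructor
  · rintro ⟨t, rfl, rfl⟩
    induction t using term_induction with
    | var a =>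
      rcases a with a | i
      · exact a.elim
      · exact .mk [] _ (by simp) (.inl ⟨e, i, _, getElem?_reverse_val e i, rfl, rfl⟩)
    | zero => exact .mk [] _ (by simp) (.inr (.inl ⟨e, rfl, rfl⟩))
    | succ t ih =>
      exact .mk [(termCode t, e, A.eval (val e) t)] _ (by simpa using ih)
        (.inr (.inr (.inl ⟨_, _, _, rfl, by rw [termCode_succT]; rfl⟩)))
    | add t s iht ihs =>
      exact .mk [(termCode t, e, A.eval (val e) t), (termCode s, e, A.eval (val e) s)] _
        (by simpa using ⟨iht, ihs⟩)
        (.inr (.inr (.inr (.inl ⟨_, _, _, _, _, rfl, by rw [termCode_addT]; rfl⟩))))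
    | mul t s iht ihs =>
      exact .mk [(termCode t, e, A.eval (val e) t), (termCode s, e, A.eval (val e) s)] _
        (by simpa using ⟨iht, ihs⟩)
        (.inr (.inr (.inr (.inr ⟨_, _, _, _, _, rfl, by rw [termCode_mulT]; rfl⟩))))
  · suffices ∀ x, Der A.valueRule x → A.HasValue x.1 x.2.1 x.2.2 from this _
    intro x h
    induction h with
    | mk ps x _ hr ih =>
      rcases hr with ⟨e, i, y, hy, rfl, rfl⟩ | ⟨e, rfl, rfl⟩ | ⟨e, l, y, rfl, rfl⟩ |
        ⟨e, l, y, m, z, rfl, rfl⟩ | ⟨e, l, y, m, z, rfl, rfl⟩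
      · have hi : i < e.length := by
          simpa using (List.getElem?_eq_some_iff.1 hy).1
        refine ⟨Term.var (Sum.inr ⟨i, hi⟩), rfl, ?_⟩
        have := getElem?_reverse_val e ⟨i, hi⟩
        rw [hy] at this
        exact (Option.some_inj.1 this).symm
      · exact ⟨zeroT, rfl, rfl⟩
      · obtain ⟨t, ht, h⟩ := ih (l, e, y) (by simp)
        exact ⟨succT t, by simp_all, congrArg A.succ h⟩
      · obtain ⟨t, ht, h⟩ := ih (l, e, y) (by simp)
        obtain ⟨s, hs, h'⟩ := ih (m, e, z) (by simp)
        exact ⟨addT t s, by simp_all, congrArg₂ A.add h h'⟩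
      · obtain ⟨t, ht, h⟩ := ih (l, e, y) (by simp)
        obtain ⟨s, hs, h'⟩ := ih (m, e, z) (by simp)
        exact ⟨mulT t s, by simp_all, congrArg₂ A.mul h h'⟩

theorem sig_hasValue (hs : Primrec A.succ) (ha : Primrec fun x : ℕ × ℕ => A.add x.1 x.2)
    (hm : Primrec fun x : ℕ × ℕ => A.mul x.1 x.2) (k : ℕ) :
    Sig k fun x : List ℕ × List ℕ × ℕ => A.HasValue x.1 x.2.1 x.2.2 := by
  refine (Sig.der (rule := A.valueRule) ?_).congr fun x => (A.hasValue_iff _ _ _).symm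
  have ha' {α : Type} [Primcodable α] {f g : α → ℕ} (hf : Primrec f) (hg : Primrec g) :
    Primrec fun a => A.add (f a) (g a) := ha.comp (hf.pair hg)
  have hm' {α : Type} [Primcodable α] {f g : α → ℕ} (hf : Primrec f) (hg : Primrec g) :
    Primrec fun a => A.mul (f a) (g a) := hm.comp (hf.pair hg)
  refine .or (.ex (.ex (.ex (.and (.eq ?_ ?_) (.and (.eq ?_ ?_) (.eq ?_ ?_))))))
    (.or (.ex (.and (.eq ?_ ?_) (.eq ?_ ?_)))
    (.or (.ex (.ex (.ex (.and (.eq ?_ ?_) (.eq ?_ ?_)))))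
    (.or (.ex (.ex (.ex (.ex (.ex (.and (.eq ?_ ?_) (.eq ?_ ?_)))))))
    (.ex (.ex (.ex (.ex (.ex (.and (.eq ?_ ?_) (.eq ?_ ?_)))))))))) <;>
    fun_prop (disch := assumption)

end TermAlg

/-- The standard interpretation. -/
def stdAlg : TermAlg := ⟨0, (· + 1), (· + ·), (· * ·)⟩

theorem eval_stdAlg {k : ℕ} (v : Fin k → ℕ) (t : LA.Term (Empty ⊕ Fin k)) :
    stdAlg.eval v t = value t v := by
  induction t using term_induction with
  | var a =>
    rcases a with a | i
    · exact a.elim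
    · rfl
  | zero => rfl
  | succ t ih => exact congrArg (· + 1) ih
  | add t s iht ihs => exact congrArg₂ (· + ·) iht ihs
  | mul t s iht ihs => exact congrArg₂ (· * ·) iht ihs

theorem sig_hasValue_stdAlg (k : ℕ) :
    Sig k fun x : List ℕ × List ℕ × ℕ => stdAlg.HasValue x.1 x.2.1 x.2.2 := by
  apply stdAlg.sig_hasValue <;> unfold stdAlg <;> fun_prop

/-- The list `l` codes a term in context `k`. -/
def IsTermCode (k : ℕ) (l : List ℕ) : Prop := ∃ t : LA.Term (Empty ⊕ Fin k), termCode t = l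

theorem sig_isTermCode (k : ℕ) : Sig k fun x : ℕ × List ℕ => IsTermCode x.1 x.2 := by
  refine (Sig.ex (p := fun (x : ℕ × List ℕ) (e : List ℕ) => ∃ y : ℕ, e.length = x.1 ∧
    stdAlg.HasValue x.2 e y) (.ex (.and (.eq ?_ ?_) ((sig_hasValue_stdAlg k).comp
      (f := fun x : ((ℕ × List ℕ) × List ℕ) × ℕ => (x.1.1.2, x.1.2, x.2)) ?_)))).congr ?_
  any_goals fun_prop
  rintro ⟨k, l⟩
  constructor
  · rintro ⟨e, y, rfl, t, rfl, -⟩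
    exact ⟨t, rfl⟩
  · obtain ⟨e, rfl⟩ : ∃ e : List ℕ, e.length = k := ⟨List.replicate k 0, by simp⟩
    exact fun ⟨t, ht⟩ => ⟨e, _, rfl, t, ht, rfl⟩

/-! ### Levels of the arithmetical hierarchy, with implication as a connective -/

/-- The formula `∀ x ≤ t, φ`, with a doubly negated scope when `c` is `false`. -/
def ballF (c : Bool) {k : ℕ} (t : LA.Term (Empty ⊕ Fin k)) (φ : LA.BoundedFormula Empty (k + 1)) :
    LA.BoundedFormula Empty k :=
  bif c then (leF (&(Fin.last k)) (liftT t) ⟹ φ).all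
  else (∼∼(leF (&(Fin.last k)) (liftT t) ⟹ φ)).all

/-- The code of `ballF`. -/
def ballFCode (c : Bool) (k : ℕ) (l m : List ℕ) : List ℕ :=
  bif c then ballCode k l m else ballNotNotCode k l m

theorem formCode_ballF (c : Bool) {k : ℕ} (t : LA.Term (Empty ⊕ Fin k))
    (φ : LA.BoundedFormula Empty (k + 1)) :
    formCode (ballF c t φ) = ballFCode c k (termCode t) (formCode φ) := by
  cases c
  · exact formCode_ballNotNot t φ
  · exact formCode_ball t φ

theorem holds_ballF (c : Bool) {k : ℕ} (t : LA.Term (Empty ⊕ Fin k))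
    (φ : LA.BoundedFormula Empty (k + 1)) (v : Fin k → ℕ) :
    Holds (ballF c t φ) v ↔ ∀ x ≤ value t v, Holds φ (Fin.snoc v x) := by
  rw [← holds_bdall]
  cases c
  · simp [ballF, Holds]
  · rfl

@[fun_prop] theorem primrec_ballFCode {α : Type} [Primcodable α] {c : α → Bool} {f : α → ℕ}
    {g h : α → List ℕ} (hc : Primrec c) (hf : Primrec f) (hg : Primrec g) (hh : Primrec h) :
    Primrec fun a => ballFCode (c a) (f a) (g a) (h a) :=
  Primrec.cond hc (by fun_prop) (by fun_prop)

/-- `InLevel true j φ` means that `φ` is `Σ_{j+1}`, and `InLevel false j φ` that it is `Π_{j+1}`,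
in a version of the hierarchy that treats implication as a connective. -/
inductive InLevel : Bool → ℕ → ∀ {k : ℕ}, LA.BoundedFormula Empty k → Prop
  | bot (s : Bool) (j : ℕ) {k : ℕ} : InLevel s j (⊥ : LA.BoundedFormula Empty k)
  | eq (s : Bool) (j : ℕ) {k : ℕ} (t₁ t₂ : LA.Term (Empty ⊕ Fin k)) : InLevel s j (t₁ =' t₂)
  | le (s : Bool) (j : ℕ) {k : ℕ} (t₁ t₂ : LA.Term (Empty ⊕ Fin k)) : InLevel s j (leF t₁ t₂)
  | imp {s : Bool} {j k : ℕ} {φ ψ : LA.BoundedFormula Empty k} :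
      InLevel (!s) j φ → InLevel s j ψ → InLevel s j (φ ⟹ ψ)
  | all {j k : ℕ} {φ : LA.BoundedFormula Empty (k + 1)} : InLevel false j φ → InLevel false j φ.all
  | ball {s : Bool} {j k : ℕ} (c : Bool) (t : LA.Term (Empty ⊕ Fin k))
      {φ : LA.BoundedFormula Empty (k + 1)} : InLevel s j φ → InLevel s j (ballF c t φ)
  | up {s : Bool} {j k : ℕ} {φ : LA.BoundedFormula Empty k} :
      InLevel (!s) j φ → InLevel s (j + 1) φ

namespace InLevel

variable {s : Bool} {j k : ℕ} {φ ψ : LA.BoundedFormula Empty k}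

theorem succ (h : InLevel s j φ) : InLevel s (j + 1) φ := by
  induction h with
  | bot s j => exact .bot _ _
  | eq s j => exact .eq _ _ _ _
  | le s j => exact .le _ _ _ _
  | imp _ _ ih₁ ih₂ => exact ih₁.imp ih₂
  | all _ ih => exact ih.all
  | ball c t _ ih => exact ih.ball c t
  | up _ ih => exact ih.up

theorem lift (h : InLevel s j φ) (s' : Bool) : InLevel s' (j + 1) φ := by
  rcases s.eq_or_eq_not s' with rfl | rfl
  · exact h.succ
  · exact h.up

theorem mono {i : ℕ} (h : InLevel s j φ) (hi : j ≤ i) : InLevel s i φ := by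
  induction hi with
  | refl => exact h
  | step _ ih => exact ih.succ

theorem not (h : InLevel (!s) j φ) : InLevel s j (∼φ) := h.imp (.bot _ _)

theorem inf (hφ : InLevel s j φ) (hψ : InLevel s j ψ) : InLevel s j (φ ⊓ ψ) :=
  .not (.imp (by simpa using hφ) (.not (by simpa using hψ)))

theorem sup (hφ : InLevel s j φ) (hψ : InLevel s j ψ) : InLevel s j (φ ⊔ ψ) :=
  .imp (.not (by simpa using hφ)) hψ

theorem exists_inLevel {k : ℕ} (φ : LA.BoundedFormula Empty k) : ∃ j, ∀ s, InLevel s j φ := by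
  induction φ using formula_induction with
  | falsum k => exact ⟨0, fun _ => .bot _ _⟩
  | equal k t s => exact ⟨0, fun _ => .eq _ _ _ _⟩
  | le k t s => exact ⟨0, fun _ => .le _ _ _ _⟩
  | imp k φ ψ ihφ ihψ =>
    obtain ⟨i, hi⟩ := ihφ
    obtain ⟨j, hj⟩ := ihψ
    exact ⟨max i j, fun s => ((hi _).mono (le_max_left _ _)).imp ((hj _).mono (le_max_right _ _))⟩
  | all k φ ih =>
    obtain ⟨j, hj⟩ := ih
    exact ⟨j + 1, (hj false).all.lift⟩

theorem of_delta0 (h : Delta0 φ) : ∀ s, InLevel s 0 φ := by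
  induction h with
  | falsum => exact fun _ => .bot _ _
  | equal t s => exact fun _ => .eq _ _ _ _
  | le t s => exact fun _ => .le _ _ _ _
  | imp _ _ ih₁ ih₂ => exact fun _ => (ih₁ _).imp (ih₂ _)
  | bdall t _ ih => exact fun s => (ih s).ball true t

end InLevel

/-- `AtLevel true n φ` means that `φ` is `Σₙ`, and `AtLevel false n φ` that it is `Πₙ`,
in the sense of `InLevel`. -/
def AtLevel (s : Bool) : ℕ → ∀ {k : ℕ}, LA.BoundedFormula Empty k → Prop
  | 0, _, φ => ∀ s, InLevel s 0 φ
  | n + 1, _, φ => InLevel s n φ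

theorem AtLevel.inLevel {s : Bool} {n k : ℕ} {φ : LA.BoundedFormula Empty k}
    (h : AtLevel s n φ) (s' : Bool) : InLevel s' n φ := by
  cases n with
  | zero => exact h s'
  | succ n => exact InLevel.lift h s'

mutual

theorem IsSigma.atLevel : ∀ {n k : ℕ} {φ : LA.BoundedFormula Empty k},
    IsSigma n φ → AtLevel true n φ
  | _, _, _, .ofDelta0 h => .of_delta0 h
  | _, _, _, .ofPi h => h.atLevel.inLevel true
  | _, _, _, .ex h => InLevel.not (.all (.not h.atLevel))
  | _, _, _, .inf h₁ h₂ => InLevel.inf h₁.atLevel h₂.atLevel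
  | _, _, _, .sup h₁ h₂ => InLevel.sup h₁.atLevel h₂.atLevel
  | _, _, _, .bdall t h => InLevel.ball true t h.atLevel

theorem IsPi.atLevel : ∀ {n k : ℕ} {φ : LA.BoundedFormula Empty k},
    IsPi n φ → AtLevel false n φ
  | _, _, _, .ofDelta0 h => .of_delta0 h
  | _, _, _, .ofSigma h => h.atLevel.inLevel false
  | _, _, _, .all h => InLevel.all h.atLevel
  | _, _, _, .inf h₁ h₂ => InLevel.inf h₁.atLevel h₂.atLevel
  | _, _, _, .sup h₁ h₂ => InLevel.sup h₁.atLevel h₂.atLevel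
  | _, _, _, .bdex t h => InLevel.not (InLevel.ball false t (.not h.atLevel))

end

/-- The list `l` codes a formula of the given level in context `k`. -/
def IsLevelCode (s : Bool) (j k : ℕ) (l : List ℕ) : Prop :=
  ∃ φ : LA.BoundedFormula Empty k, InLevel s j φ ∧ formCode φ = l

/-- The rules that generate the codes of the formulas of each level. -/
def levelRule (ps : List (Bool × ℕ × ℕ × List ℕ)) (x : Bool × ℕ × ℕ × List ℕ) : Prop :=
  (∃ s j k, ps = [] ∧ x = (s, j, k, botCode k)) ∨
  (∃ s j k l m, IsTermCode k l ∧ IsTermCode k m ∧ ps = [] ∧ x = (s, j, k, eqCode k l m)) ∨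
  (∃ s j k l m, IsTermCode k l ∧ IsTermCode k m ∧ ps = [] ∧ x = (s, j, k, leCode k l m)) ∨
  (∃ s j k l m, ps = [(!s, j, k, l), (s, j, k, m)] ∧ x = (s, j, k, impCode l m)) ∨
  (∃ j k l, ps = [(false, j, k + 1, l)] ∧ x = (false, j, k, allCode l)) ∨
  (∃ s j k l m c, IsTermCode k l ∧ ps = [(s, j, k + 1, m)] ∧ x = (s, j, k, ballFCode c k l m)) ∨
  (∃ s j k l, ps = [(!s, j, k, l)] ∧ x = (s, j + 1, k, l))

theorem isLevelCode_iff (s : Bool) (j k : ℕ) (l : List ℕ) :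
    IsLevelCode s j k l ↔ Der levelRule (s, j, k, l) := by
  constructor
  · rintro ⟨φ, h, rfl⟩
    induction h with
    | bot s j => exact .mk [] _ (by simp) (.inl ⟨_, _, _, rfl, by rw [formCode_bot]⟩)
    | eq s j t₁ t₂ =>
      exact .mk [] _ (by simp)
        (.inr (.inl ⟨_, _, _, _, _, ⟨t₁, rfl⟩, ⟨t₂, rfl⟩, rfl, by rw [formCode_eq]⟩))
    | le s j t₁ t₂ =>
      exact .mk [] _ (by simp)
        (.inr (.inr (.inl ⟨_, _, _, _, _, ⟨t₁, rfl⟩, ⟨t₂, rfl⟩, rfl, by rw [formCode_leF]⟩)))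
    | @imp s j k φ ψ _ _ ih₁ ih₂ =>
      exact .mk [(!s, j, k, formCode φ), (s, j, k, formCode ψ)] _ (by simpa using ⟨ih₁, ih₂⟩)
        (.inr (.inr (.inr (.inl ⟨_, _, _, _, _, rfl, by rw [formCode_imp]⟩))))
    | @all j k φ _ ih =>
      exact .mk [(false, j, k + 1, formCode φ)] _ (by simpa using ih)
        (.inr (.inr (.inr (.inr (.inl ⟨_, _, _, rfl, by rw [formCode_all]⟩)))))
    | @ball s j k c t φ _ ih =>
      exact .mk [(s, j, k + 1, formCode φ)] _ (by simpa using ih)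
        (.inr (.inr (.inr (.inr (.inr (.inl
          ⟨_, _, _, _, _, c, ⟨t, rfl⟩, rfl, by rw [formCode_ballF]⟩))))))
    | @up s j k φ _ ih =>
      exact .mk [(!s, j, k, formCode φ)] _ (by simpa using ih)
        (.inr (.inr (.inr (.inr (.inr (.inr ⟨_, _, _, _, rfl, rfl⟩))))))
  · suffices ∀ x, Der levelRule x → IsLevelCode x.1 x.2.1 x.2.2.1 x.2.2.2 from this _
    intro x h
    induction h with
    | mk ps x _ hr ih =>
      rcases hr with ⟨s, j, k, rfl, rfl⟩ | ⟨s, j, k, l, m, ⟨t₁, rfl⟩, ⟨t₂, rfl⟩, rfl, rfl⟩ |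
        ⟨s, j, k, l, m, ⟨t₁, rfl⟩, ⟨t₂, rfl⟩, rfl, rfl⟩ | ⟨s, j, k, l, m, rfl, rfl⟩ |
        ⟨j, k, l, rfl, rfl⟩ | ⟨s, j, k, l, m, c, ⟨t, rfl⟩, rfl, rfl⟩ | ⟨s, j, k, l, rfl, rfl⟩
      · exact ⟨_, .bot _ _, formCode_bot⟩
      · exact ⟨_, .eq _ _ _ _, formCode_eq _ _⟩
      · exact ⟨_, .le _ _ _ _, formCode_leF _ _⟩
      · obtain ⟨φ, hφ, e⟩ := ih (!s, j, k, l) (by simp)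
        obtain ⟨ψ, hψ, e'⟩ := ih (s, j, k, m) (by simp)
        exact ⟨_, hφ.imp hψ, by simp_all⟩
      · obtain ⟨φ, hφ, e⟩ := ih (false, j, k + 1, l) (by simp)
        exact ⟨_, hφ.all, by simp_all⟩
      · obtain ⟨φ, hφ, e⟩ := ih (s, j, k + 1, m) (by simp)
        exact ⟨_, hφ.ball c t, by simp_all [formCode_ballF]⟩
      · obtain ⟨φ, hφ, e⟩ := ih (!s, j, k, l) (by simp)
        exact ⟨φ, hφ.up, e⟩

theorem sig_isLevelCode (i : ℕ) :
    Sig i fun x : Bool × ℕ × ℕ × List ℕ => IsLevelCode x.1 x.2.1 x.2.2.1 x.2.2.2 := by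
  refine (Sig.der (rule := levelRule) ?_).congr fun x => (isLevelCode_iff _ _ _ _).symm
  have ht {α : Type} [Primcodable α] {f : α → ℕ} {g : α → List ℕ} (hf : Primrec f)
      (hg : Primrec g) : Sig i fun a => IsTermCode (f a) (g a) :=
    (sig_isTermCode i).comp (hf.pair hg)
  refine .or (.ex (.ex (.ex (.and (.eq ?_ ?_) (.eq ?_ ?_)))))
    (.or (.ex (.ex (.ex (.ex (.ex
      (.and (ht ?_ ?_) (.and (ht ?_ ?_) (.and (.eq ?_ ?_) (.eq ?_ ?_)))))))))
    (.or (.ex (.ex (.ex (.ex (.ex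
      (.and (ht ?_ ?_) (.and (ht ?_ ?_) (.and (.eq ?_ ?_) (.eq ?_ ?_)))))))))
    (.or (.ex (.ex (.ex (.ex (.ex (.and (.eq ?_ ?_) (.eq ?_ ?_)))))))
    (.or (.ex (.ex (.ex (.and (.eq ?_ ?_) (.eq ?_ ?_)))))
    (.or (.ex (.ex (.ex (.ex (.ex (.ex (.and (ht ?_ ?_) (.and (.eq ?_ ?_) (.eq ?_ ?_)))))))))
    (.ex (.ex (.ex (.ex (.and (.eq ?_ ?_) (.eq ?_ ?_))))))))))) <;> fun_prop

/-- The list `l` codes a formula in context `k`. -/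
def IsFormCode (k : ℕ) (l : List ℕ) : Prop := ∃ φ : LA.BoundedFormula Empty k, formCode φ = l

theorem sig_isFormCode (i : ℕ) : Sig i fun x : ℕ × List ℕ => IsFormCode x.1 x.2 := by
  refine (Sig.ex (p := fun (x : ℕ × List ℕ) j => IsLevelCode true j x.1 x.2)
    ((sig_isLevelCode i).comp (f := fun x : (ℕ × List ℕ) × ℕ => (true, x.2, x.1.1, x.1.2))
      (by fun_prop))).congr fun x => ?_
  constructor
  · rintro ⟨j, φ, -, h⟩
    exact ⟨φ, h⟩
  · rintro ⟨φ, h⟩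
    obtain ⟨j, hj⟩ := InLevel.exists_inLevel φ
    exact ⟨j, φ, hj _, h⟩

/-! ### Partial satisfaction classes -/

/-- The list `l` codes a formula that is `Σ_{j+1}` and true in the environment `e` (for `s = true`),
respectively `Π_{j+1}` and false (for `s = false`). -/
def Sat (j : ℕ) (s : Bool) (l e : List ℕ) : Prop :=
  ∃ φ : LA.BoundedFormula Empty e.length,
    InLevel s j φ ∧ formCode φ = l ∧ (Holds φ (val e) ↔ s = true)

/-- The formulas decided by the satisfaction class of the preceding level. -/
def SatLeaf : ℕ → Bool → List ℕ → List ℕ → Prop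
  | 0, _, _, _ => False
  | j + 1, s, l, e => IsLevelCode (!s) j e.length l ∧ ¬ Sat j (!s) l e

/-- The rules that generate the satisfaction class of level `j`. -/
def satRule (j : ℕ) (ps : List (Bool × List ℕ × List ℕ)) (x : Bool × List ℕ × List ℕ) : Prop :=
  (∃ e, ps = [] ∧ x = (false, botCode e.length, e)) ∨
  (∃ e l m y z, stdAlg.HasValue l e y ∧ stdAlg.HasValue m e z ∧
    ps = [] ∧ x = (y == z, eqCode e.length l m, e)) ∨
  (∃ e l m y z, stdAlg.HasValue l e y ∧ stdAlg.HasValue m e z ∧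
    ps = [] ∧ x = (decide (y ≤ z), leCode e.length l m, e)) ∨
  (∃ e l m, ps = [(true, l, e), (false, m, e)] ∧ x = (false, impCode l m, e)) ∨
  (∃ e l m, IsLevelCode true j e.length m ∧ ps = [(false, l, e)] ∧ x = (true, impCode l m, e)) ∨
  (∃ e l m, IsLevelCode false j e.length l ∧ ps = [(true, m, e)] ∧ x = (true, impCode l m, e)) ∨
  (∃ e l y, ps = [(false, l, y :: e)] ∧ x = (false, allCode l, e)) ∨
  (∃ e l m b y c, stdAlg.HasValue l e b ∧ y ≤ b ∧ ps = [(false, m, y :: e)] ∧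
    x = (false, ballFCode c e.length l m, e)) ∨
  (∃ e l m b c, stdAlg.HasValue l e b ∧
    ps = (List.range (b + 1)).map (fun y => (true, m, y :: e)) ∧
    x = (true, ballFCode c e.length l m, e)) ∨
  (ps = [] ∧ SatLeaf j x.1 x.2.1 x.2.2)

theorem Sat.of_der {j : ℕ} {x : Bool × List ℕ × List ℕ} (h : Der (satRule j) x) :
    Sat j x.1 x.2.1 x.2.2 := by
  induction h with
  | mk ps x _ hr ih =>
    rcases hr with ⟨e, rfl, rfl⟩ | ⟨e, l, m, y, z, ⟨t, rfl, rfl⟩, ⟨u, rfl, rfl⟩, rfl, rfl⟩ |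
      ⟨e, l, m, y, z, ⟨t, rfl, rfl⟩, ⟨u, rfl, rfl⟩, rfl, rfl⟩ | ⟨e, l, m, rfl, rfl⟩ |
      ⟨e, l, m, ⟨ψ, hψ, e'⟩, rfl, rfl⟩ | ⟨e, l, m, ⟨φ, hφ, e'⟩, rfl, rfl⟩ | ⟨e, l, y, rfl, rfl⟩ |
      ⟨e, l, m, b, y, c, ⟨t, rfl, rfl⟩, hb, rfl, rfl⟩ | ⟨e, l, m, b, c, ⟨t, rfl, rfl⟩, rfl, rfl⟩ |
      ⟨rfl, hr⟩
    · exact ⟨⊥, .bot _ _, formCode_bot, by simp [Holds]⟩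
    · exact ⟨t =' u, .eq _ _ _ _, formCode_eq _ _, by simp [Holds, eval_stdAlg]⟩
    · exact ⟨leF t u, .le _ _ _ _, formCode_leF _ _, by simp [Holds, eval_stdAlg]⟩
    · obtain ⟨φ, hφ, e', h⟩ := ih (true, l, e) (by simp)
      obtain ⟨ψ, hψ, e'', h'⟩ := ih (false, m, e) (by simp)
      exact ⟨φ ⟹ ψ, InLevel.imp (s := false) hφ hψ, by simp_all, by simp_all [Holds]⟩
    · obtain ⟨φ, hφ, e'', h⟩ := ih (false, l, e) (by simp)
      exact ⟨φ ⟹ ψ, InLevel.imp (s := true) hφ hψ, by simp_all, by simp_all [Holds]⟩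
    · obtain ⟨ψ, hψ, e'', h⟩ := ih (true, m, e) (by simp)
      exact ⟨φ ⟹ ψ, InLevel.imp (s := true) hφ hψ, by simp_all, by simp_all [Holds]⟩
    · obtain ⟨φ, hφ, e', h⟩ := ih (false, l, y :: e) (by simp)
      refine ⟨BoundedFormula.all φ, hφ.all, (formCode_all φ).trans (congrArg _ e'), ?_⟩
      simp only [Holds, realize_all, Bool.false_eq_true, iff_false] at h ⊢
      exact fun H => h (H y)
    · obtain ⟨φ, hφ, e', h⟩ := ih (false, m, y :: e) (by simp)
      refine ⟨ballF c t φ, hφ.ball c t, (formCode_ballF c t φ).trans 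
        (congrArg (ballFCode c e.length (termCode t)) e'), ?_⟩
      simp only [holds_ballF, Bool.false_eq_true, iff_false] at h ⊢
      rw [eval_stdAlg] at hb
      exact fun H => h (H y hb)
    · have := fun y (hy : y ≤ stdAlg.eval (val e) t) => ih (true, m, y :: e)
        (List.mem_map.2 ⟨y, List.mem_range.2 (by omega), rfl⟩)
      obtain ⟨φ, hφ, e', -⟩ := this 0 (Nat.zero_le _)
      refine ⟨ballF c t φ, hφ.ball c t, (formCode_ballF c t φ).trans 
        (congrArg (ballFCode c e.length (termCode t)) e'), ?_⟩
      simp only [holds_ballF, iff_true]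
      intro y hy
      obtain ⟨ψ, -, e'', h⟩ := this y (by rwa [eval_stdAlg])
      obtain rfl : φ = ψ := formCode_injective (k := e.length + 1) (e'.trans e''.symm)
      exact h.2 rfl
    · cases j with
      | zero => exact hr.elim
      | succ j =>
        obtain ⟨⟨φ, hφ, e⟩, h⟩ := hr
        refine ⟨φ, hφ.up, e, ?_⟩
        by_contra H
        refine h ⟨φ, hφ, e, ?_⟩
        revert H
        cases x.1 <;> simp

theorem der_satRule {j : ℕ} {s : Bool} {k : ℕ} {φ : LA.BoundedFormula Empty k}
    (h : InLevel s j φ) : ∀ (e : List ℕ) (he : e.length = k),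
    (Holds φ (fun i => val e (Fin.cast he.symm i)) ↔ s = true) →
      Der (satRule j) (s, formCode φ, e) := by
  induction h with
  | bot s j =>
    rintro e rfl h
    obtain rfl : s = false := by simpa [Holds] using h
    exact .mk [] _ (by simp) (.inl ⟨e, rfl, by rw [formCode_bot]⟩)
  | eq s j t u =>
    rintro e rfl h
    refine .mk [] _ (by simp) (.inr (.inl ⟨e, _, _, _, _, ⟨t, rfl, rfl⟩, ⟨u, rfl, rfl⟩, rfl, ?_⟩))
    rw [formCode_eq, eval_stdAlg, eval_stdAlg]
    congr
    rw [Bool.eq_iff_iff, ← h]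
    simp [Holds]
  | le s j t u =>
    rintro e rfl h
    refine .mk [] _ (by simp)
      (.inr (.inr (.inl ⟨e, _, _, _, _, ⟨t, rfl, rfl⟩, ⟨u, rfl, rfl⟩, rfl, ?_⟩)))
    rw [formCode_leF, eval_stdAlg, eval_stdAlg]
    congr
    rw [Bool.eq_iff_iff, ← h]
    simp [Holds]
  | @imp s j k φ ψ hφ hψ ihφ ihψ =>
    rintro e rfl h
    rw [formCode_imp]
    replace ihφ := ihφ e rfl
    replace ihψ := ihψ e rfl
    simp only [Holds, realize_imp] at h ihφ ihψ
    cases s with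
    | false =>
      simp only [Bool.false_eq_true, iff_false, Classical.not_imp] at h
      exact .mk [(true, formCode φ, e), (false, formCode ψ, e)] _
        (by simpa using ⟨ihφ (by simpa using h.1), ihψ (by simpa using h.2)⟩)
        (.inr (.inr (.inr (.inl ⟨e, _, _, rfl, rfl⟩))))
    | true =>
      simp only [iff_true, imp_iff_not_or] at h
      rcases h with h | h
      · exact .mk [(false, formCode φ, e)] _ (by simpa using ihφ (by simpa using h))
          (.inr (.inr (.inr (.inr (.inl ⟨e, _, _, ⟨ψ, hψ, rfl⟩, rfl, rfl⟩)))))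
      · exact .mk [(true, formCode ψ, e)] _ (by simpa using ihψ (by simpa using h))
          (.inr (.inr (.inr (.inr (.inr (.inl ⟨e, _, _, ⟨φ, hφ, rfl⟩, rfl, rfl⟩))))))
  | @all j k φ _ ih =>
    rintro e rfl h
    rw [formCode_all]
    simp only [Holds, realize_all, Bool.false_eq_true, iff_false, not_forall] at h
    obtain ⟨y, hy⟩ := h
    exact .mk [(false, formCode φ, y :: e)] _
      (by simpa using ih (y :: e) rfl ⟨fun H => (hy H).elim, by simp⟩)
      (.inr (.inr (.inr (.inr (.inr (.inr (.inl ⟨e, _, y, rfl, rfl⟩)))))))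
  | @ball s j k c t φ _ ih =>
    rintro e rfl h
    rw [formCode_ballF]
    rw [holds_ballF] at h
    cases s with
    | false =>
      simp only [Bool.false_eq_true, iff_false, not_forall] at h
      obtain ⟨y, hb, hy⟩ := h
      exact .mk [(false, formCode φ, y :: e)] _
        (by simpa using ih (y :: e) rfl ⟨fun H => (hy H).elim, by simp⟩)
        (.inr (.inr (.inr (.inr (.inr (.inr (.inr (.inl ⟨e, _, _, _, y, c, ⟨t, rfl, rfl⟩,
          (eval_stdAlg _ _).symm ▸ hb, rfl, rfl⟩))))))))
    | true =>
      simp only [iff_true] at h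
      refine .mk
        ((List.range (stdAlg.eval (val e) t + 1)).map (fun y => (true, formCode φ, y :: e))) _
        (fun z hz => ?_) (.inr (.inr (.inr (.inr (.inr (.inr (.inr (.inr (.inl
          ⟨e, _, _, _, c, ⟨t, rfl, rfl⟩, rfl, rfl⟩)))))))))
      obtain ⟨y, hy, rfl⟩ := List.mem_map.1 hz
      rw [List.mem_range, eval_stdAlg] at hy
      exact ih (y :: e) rfl ⟨fun _ => rfl, fun _ => h y (Nat.lt_succ_iff.1 hy)⟩
  | @up s j k φ hφ _ =>
    rintro e rfl h
    refine .mk [] _ (by simp) (.inr (.inr (.inr (.inr (.inr (.inr (.inr (.inr (.inr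
      ⟨rfl, ⟨φ, hφ, rfl⟩, ?_⟩)))))))))
    rintro ⟨ψ, -, e', h'⟩
    have hψ : ψ = φ := formCode_injective e'
    rw [hψ] at h'
    simp only [Fin.cast_eq_self] at h
    rw [h] at h'
    revert h'
    cases s <;> simp

theorem sat_iff (j : ℕ) (s : Bool) (l e : List ℕ) : Sat j s l e ↔ Der (satRule j) (s, l, e) := by
  constructor
  · rintro ⟨φ, hφ, rfl, h⟩
    exact der_satRule hφ e rfl h
  · exact Sat.of_der

theorem sig_sat (j : ℕ) :
    Sig j fun x : Bool × List ℕ × List ℕ => Sat j x.1 x.2.1 x.2.2 := by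
  have hleaf : Sig j fun x : Bool × List ℕ × List ℕ => SatLeaf j x.1 x.2.1 x.2.2 := by
    cases j with
    | zero => exact Sig.false
    | succ j =>
      exact ((sig_isLevelCode _).comp (f := fun x : Bool × List ℕ × List ℕ =>
        (!x.1, j, x.2.2.length, x.2.1)) (by fun_prop)).and
        ((sig_sat j).not.comp (f := fun x : Bool × List ℕ × List ℕ => (!x.1, x.2)) (by fun_prop))
  refine (Sig.der (rule := satRule j) ?_).congr fun x => (sat_iff _ _ _ _).symm
  have hv {α : Type} [Primcodable α] {f g : α → List ℕ} {h : α → ℕ} (hf : Primrec f)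
      (hg : Primrec g) (hh : Primrec h) : Sig j fun a => stdAlg.HasValue (f a) (g a) (h a) :=
    (sig_hasValue_stdAlg j).comp (hf.pair (hg.pair hh))
  have hc {α : Type} [Primcodable α] (s : Bool) {f : α → ℕ} {g : α → List ℕ} (hf : Primrec f)
      (hg : Primrec g) : Sig j fun a => IsLevelCode s j (f a) (g a) :=
    (sig_isLevelCode j).comp (f := fun a => (s, j, f a, g a)) (by fun_prop)
  have hbeq {α : Type} [Primcodable α] {f g : α → ℕ} (hf : Primrec f) (hg : Primrec g) :
      Primrec fun a => f a == g a := Primrec.beq.comp hf hg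
  have hle {α : Type} [Primcodable α] {f g : α → ℕ} (hf : Primrec f) (hg : Primrec g) :
      Primrec fun a => decide (f a ≤ g a) := (Primrec.nat_le.comp hf hg).decide
  refine .or (.ex (.and (.eq ?_ ?_) (.eq ?_ ?_)))
    (.or (.ex (.ex (.ex (.ex (.ex (.and (hv ?_ ?_ ?_) (.and (hv ?_ ?_ ?_)
      (.and (.eq ?_ ?_) (.eq ?_ (.pair (hbeq ?_ ?_) ?_))))))))))
    (.or (.ex (.ex (.ex (.ex (.ex (.and (hv ?_ ?_ ?_) (.and (hv ?_ ?_ ?_)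
      (.and (.eq ?_ ?_) (.eq ?_ (.pair (hle ?_ ?_) ?_))))))))))
    (.or (.ex (.ex (.ex (.and (.eq ?_ ?_) (.eq ?_ ?_)))))
    (.or (.ex (.ex (.ex (.and (hc _ ?_ ?_) (.and (.eq ?_ ?_) (.eq ?_ ?_))))))
    (.or (.ex (.ex (.ex (.and (hc _ ?_ ?_) (.and (.eq ?_ ?_) (.eq ?_ ?_))))))
    (.or (.ex (.ex (.ex (.and (.eq ?_ ?_) (.eq ?_ ?_)))))
    (.or (.ex (.ex (.ex (.ex (.ex (.ex (.and (hv ?_ ?_ ?_) (.and (.le ?_ ?_)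
      (.and (.eq ?_ ?_) (.eq ?_ ?_))))))))))
    (.or (.ex (.ex (.ex (.ex (.ex (.and (hv ?_ ?_ ?_)
      (.and (.eq ?_ (primrec_map ?_ ?_)) (.eq ?_ ?_))))))))
    (.and (.eq ?_ ?_) (hleaf.comp ?_)))))))))) <;> fun_prop

/-! ### A basis theorem for sets of clauses -/

/-- A literal is true under the valuation `V`. -/
def Lit (V : ℕ → Prop) (p : Bool × ℕ) : Prop := V p.2 ↔ p.1 = true

theorem lit_not (V : ℕ → Prop) (b : Bool) (i : ℕ) : Lit V (!b, i) ↔ ¬ Lit V (b, i) := by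
  cases b <;> simp [Lit]

section Basis

variable (C : List (Bool × ℕ) → Prop)

/-- A set of literals is refuted if it contradicts a clause, or if it is refuted after adding either
of two complementary literals. -/
def refuteRule (ps : List (List (Bool × ℕ))) (s : List (Bool × ℕ)) : Prop :=
  (ps = [] ∧ ∃ q, C q ∧ ∀ p ∈ q, (!p.1, p.2) ∈ s) ∨
    ∃ i, ps = [(true, i) :: s, (false, i) :: s]

theorem exists_not_lit_of_der {V : ℕ → Prop} (hV : ∀ q, C q → ∃ p ∈ q, Lit V p)
    {s : List (Bool × ℕ)} (h : Der (refuteRule C) s) : ∃ p ∈ s, ¬ Lit V p := by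
  induction h with
  | mk ps s _ hr ih =>
    rcases hr with ⟨rfl, q, hq, hs⟩ | ⟨i, rfl⟩
    · obtain ⟨p, hp, h⟩ := hV q hq
      exact ⟨_, hs p hp, by rwa [lit_not, not_not]⟩
    · by_contra! H
      have h₁ : ¬ Lit V (true, i) := by
        obtain ⟨p, hp, h⟩ := ih _ List.mem_cons_self
        rcases List.mem_cons.1 hp with rfl | hp
        exacts [h, (h (H p hp)).elim]
      have h₂ : ¬ Lit V (false, i) := by
        obtain ⟨p, hp, h⟩ := ih _ (List.mem_cons_of_mem _ List.mem_cons_self)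
        rcases List.mem_cons.1 hp with rfl | hp
        exacts [h, (h (H p hp)).elim]
      exact h₁ ((lit_not V false i).2 h₂)

open Classical in
/-- The leftmost path of literals that is not refuted. -/
noncomputable def path : ℕ → List (Bool × ℕ)
  | 0 => []
  | k + 1 => (decide (¬ Der (refuteRule C) ((true, k) :: path k)), k) :: path k

theorem length_path (k : ℕ) : (path C k).length = k := by
  induction k with
  | zero => rfl
  | succ k ih => simp [path, ih]

theorem not_der_path (h : ¬ Der (refuteRule C) []) (k : ℕ) : ¬ Der (refuteRule C) (path C k) := by
  induction k with
  | zero => exact h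
  | succ k ih =>
    by_cases H : Der (refuteRule C) ((true, k) :: path C k)
    · simp only [path, H, not_true_eq_false, decide_false]
      exact fun H' => ih (.mk _ _ (by simpa using ⟨H, H'⟩) (.inr ⟨k, rfl⟩))
    · simp only [path, H, not_false_eq_true, decide_true]

/-- The valuation given by the leftmost path. -/
def leftVal (i : ℕ) : Prop := ¬ Der (refuteRule C) ((true, i) :: path C i)

theorem mem_path {b : Bool} {i k : ℕ} (hi : i < k) (h : Lit (leftVal C) (b, i)) :
    (b, i) ∈ path C k := by
  induction k with
  | zero => omega
  | succ k ih =>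
    rcases Nat.lt_succ_iff_lt_or_eq.1 hi with hi | rfl
    · exact List.mem_cons_of_mem _ (ih hi)
    · refine List.mem_cons.2 (.inl (Prod.ext ?_ rfl))
      exact Bool.eq_iff_iff.2 (h.symm.trans (by simp [leftVal]))

theorem exists_lit_leftVal (h : ¬ Der (refuteRule C) []) {q : List (Bool × ℕ)} (hq : C q) :
    ∃ p ∈ q, Lit (leftVal C) p := by
  by_contra! H
  obtain ⟨k, hk⟩ : ∃ k, ∀ p ∈ q, p.2 < k := by
    refine ⟨(q.map Prod.snd).sum + 1, fun p hp => Nat.lt_succ_iff.2 ?_⟩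
    exact List.single_le_sum (fun _ _ => Nat.zero_le _) _ (List.mem_map_of_mem hp)
  refine not_der_path C h k (.mk [] _ (by simp) (.inl ⟨rfl, q, hq, fun p hp => ?_⟩))
  exact mem_path C (hk p hp) ((lit_not _ _ _).2 (H p hp))

/-- The rules that generate the leftmost path. -/
def pathRule (ps : List (List (Bool × ℕ))) (s : List (Bool × ℕ)) : Prop :=
  (ps = [] ∧ s = []) ∨ ∃ t, ps = [t] ∧
    ((s = (true, t.length) :: t ∧ ¬ Der (refuteRule C) ((true, t.length) :: t)) ∨
      (s = (false, t.length) :: t ∧ Der (refuteRule C) ((true, t.length) :: t)))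

theorem der_pathRule_iff (s : List (Bool × ℕ)) :
    Der (pathRule C) s ↔ s = path C s.length := by
  constructor
  · intro h
    induction h with
    | mk ps s _ hr ih =>
      rcases hr with ⟨rfl, rfl⟩ | ⟨t, rfl, ⟨rfl, h⟩ | ⟨rfl, h⟩⟩
      · rfl
      all_goals
        have ht := ih t (by simp)
        simp only [List.length_cons, path, ← ht, h, not_true_eq_false, not_false_eq_true,
          decide_true, decide_false]
  · generalize s.length = k
    rintro rfl
    induction k with
    | zero => exact .mk [] _ (by simp) (.inl ⟨rfl, rfl⟩)
    | succ k ih =>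
      refine .mk [path C k] _ (by simpa using ih) (.inr ⟨_, rfl, ?_⟩)
      rw [length_path]
      by_cases H : Der (refuteRule C) ((true, k) :: path C k)
      · exact .inr ⟨by simp [path, H], H⟩
      · exact .inl ⟨by simp [path, H], H⟩

theorem sig_leftVal {n : ℕ} (hC : Sig n C) : Sig (n + 1) (leftVal C) := by
  have hr : Sig n (Der (refuteRule C)) := by
    refine .der (.or (.and (.eq ?_ ?_) (.ex (.and (hC.comp ?_) (.ball_mem ?_ (.mem ?_ ?_)))))
      (.ex (.eq ?_ ?_))) <;> fun_prop
  have hp : Sig (n + 1) (Der (pathRule C)) := by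
    refine .der (.or (.and (.eq ?_ ?_) (.eq ?_ ?_)) (.ex (.and (.eq ?_ ?_)
      (.or (.and (.eq ?_ ?_) (hr.not.comp
          (f := fun x : (List (List (Bool × ℕ)) × List (Bool × ℕ)) × List (Bool × ℕ) =>
            (true, x.2.length) :: x.2) ?_))
        (.and (.eq ?_ ?_) (hr.succ.comp
          (f := fun x : (List (List (Bool × ℕ)) × List (Bool × ℕ)) × List (Bool × ℕ) =>
            (true, x.2.length) :: x.2) ?_)))))) <;> fun_prop
  refine (Sig.ex (p := fun (i : ℕ) (s : List (Bool × ℕ)) => Der (pathRule C) s ∧ s.length = i ∧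
    ¬ Der (refuteRule C) ((true, i) :: s)) (.and (hp.comp ?_) (.and (.eq ?_ ?_) (hr.not.comp
      (f := fun x : ℕ × List (Bool × ℕ) => (true, x.1) :: x.2) ?_)))).congr fun i => ?_
  any_goals fun_prop
  constructor
  · rintro ⟨s, hs, rfl, h⟩
    rw [der_pathRule_iff] at hs
    rwa [leftVal, ← hs]
  · exact fun h => ⟨path C i, (der_pathRule_iff C _).2 (by rw [length_path]), length_path C i, h⟩

/-- A satisfiable `Σ_{n+1}` set of clauses is satisfied by a valuation that is `Σ_{n+2}`. -/
theorem exists_sig_valuation {n : ℕ} (hC : Sig n C) {V : ℕ → Prop}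
    (hV : ∀ q, C q → ∃ p ∈ q, Lit V p) :
    ∃ W : ℕ → Prop, Sig (n + 1) W ∧ ∀ q, C q → ∃ p ∈ q, Lit W p := by
  refine ⟨leftVal C, sig_leftVal C hC, fun q hq => exists_lit_leftVal C (fun h => ?_) hq⟩
  obtain ⟨p, hp, -⟩ := exists_not_lit_of_der C hV h
  simp at hp

end Basis

/-! ### Henkin clauses -/

/-- The interpretation of the function symbols by Henkin constants. -/
def henkinAlg : TermAlg where
  zero := 0
  succ x := Nat.pair 0 x + 1
  add x y := Nat.pair 1 (Nat.pair x y) + 1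
  mul x y := Nat.pair 2 (Nat.pair x y) + 1

/-- The Henkin constant that witnesses the failure of `∀ x, φ`, where `φ` is coded by `l`. -/
def wit (l e : List ℕ) : ℕ := Nat.pair 3 (encode (l, e)) + 1

/-- The propositional atom stating that the formula coded by `l` holds in the environment `e`. -/
def atom (l e : List ℕ) : ℕ := encode (l, e)

/-- The propositional atom stating that `x` and `y` are equal. -/
def eqAtom (x y : ℕ) : ℕ := atom (eqCode 2 [2] [6]) [y, x]

/-- The propositional atom stating that `x` is at most `y`. -/
def leAtom (x y : ℕ) : ℕ := atom (leCode 2 [2] [6]) [y, x]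

/-- The clauses for the logical symbols. -/
def LogicClause (q : List (Bool × ℕ)) : Prop :=
  (∃ e, q = [(false, atom (botCode e.length) e)]) ∨
  (∃ e l m, IsFormCode e.length l ∧ IsFormCode e.length m ∧
    (q = [(false, atom (impCode l m) e), (false, atom l e), (true, atom m e)] ∨
      q = [(true, atom (impCode l m) e), (true, atom l e)] ∨
      q = [(true, atom (impCode l m) e), (false, atom m e)])) ∨
  (∃ e l x, IsFormCode (e.length + 1) l ∧
    (q = [(false, atom (allCode l) e), (true, atom l (x :: e))] ∨
      q = [(true, atom (allCode l) e), (false, atom l (wit l e :: e))]))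

/-- The clauses that reduce atomic formulas to relations between Henkin constants. -/
def AtomicClause (q : List (Bool × ℕ)) : Prop :=
  ∃ e l m y z b, henkinAlg.HasValue l e y ∧ henkinAlg.HasValue m e z ∧
    (q = [(b, atom (eqCode e.length l m) e), (!b, eqAtom y z)] ∨
      q = [(b, atom (leCode e.length l m) e), (!b, leAtom y z)])

/-- The clauses for equality. -/
def EqClause (q : List (Bool × ℕ)) : Prop :=
  (∃ x, q = [(true, eqAtom x x)]) ∨
  (∃ x y z, q = [(false, eqAtom x y), (false, eqAtom x z), (true, eqAtom y z)]) ∨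
  (∃ x y, q = [(false, eqAtom x y), (true, eqAtom (henkinAlg.succ x) (henkinAlg.succ y))]) ∨
  (∃ x w y z, q = [(false, eqAtom x w), (false, eqAtom y z),
      (true, eqAtom (henkinAlg.add x y) (henkinAlg.add w z))] ∨
    q = [(false, eqAtom x w), (false, eqAtom y z),
      (true, eqAtom (henkinAlg.mul x y) (henkinAlg.mul w z))] ∨
    q = [(false, eqAtom x w), (false, eqAtom y z), (false, leAtom x y), (true, leAtom w z)])

/-- The Henkin clauses of the theory whose axioms are coded by the elements of `A`. -/
def HenkinClause (A : List ℕ → Prop) (q : List (Bool × ℕ)) : Prop :=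
  LogicClause q ∨ AtomicClause q ∨ EqClause q ∨ ∃ l, A l ∧ q = [(true, atom l [])]

section Definability

variable {α : Type} [Primcodable α]

@[fun_prop] theorem primrec_henkin_succ {f : α → ℕ} (hf : Primrec f) :
    Primrec fun a => henkinAlg.succ (f a) := by
  unfold henkinAlg; fun_prop

@[fun_prop] theorem primrec_henkin_add {f g : α → ℕ} (hf : Primrec f) (hg : Primrec g) :
    Primrec fun a => henkinAlg.add (f a) (g a) := by
  unfold henkinAlg; fun_prop

@[fun_prop] theorem primrec_henkin_mul {f g : α → ℕ} (hf : Primrec f) (hg : Primrec g) :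
    Primrec fun a => henkinAlg.mul (f a) (g a) := by
  unfold henkinAlg; fun_prop

@[fun_prop] theorem primrec_wit {f g : α → List ℕ} (hf : Primrec f) (hg : Primrec g) :
    Primrec fun a => wit (f a) (g a) := by
  unfold wit; fun_prop

@[fun_prop] theorem primrec_atom {f g : α → List ℕ} (hf : Primrec f) (hg : Primrec g) :
    Primrec fun a => atom (f a) (g a) := by
  unfold atom; fun_prop

@[fun_prop] theorem primrec_eqAtom {f g : α → ℕ} (hf : Primrec f) (hg : Primrec g) :
    Primrec fun a => eqAtom (f a) (g a) := by
  unfold eqAtom; fun_prop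

@[fun_prop] theorem primrec_leAtom {f g : α → ℕ} (hf : Primrec f) (hg : Primrec g) :
    Primrec fun a => leAtom (f a) (g a) := by
  unfold leAtom; fun_prop

theorem sig_logicClause (n : ℕ) : Sig n LogicClause := by
  have hf {α : Type} [Primcodable α] {f : α → ℕ} {g : α → List ℕ} (hf : Primrec f)
      (hg : Primrec g) : Sig n fun a => IsFormCode (f a) (g a) :=
    (sig_isFormCode n).comp (f := fun a => (f a, g a)) (by fun_prop)
  refine .or (.ex (.eq ?_ ?_)) (.or (.ex (.ex (.ex (.and (hf ?_ ?_) (.and (hf ?_ ?_)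
    (.or (.eq ?_ ?_) (.or (.eq ?_ ?_) (.eq ?_ ?_))))))))
    (.ex (.ex (.ex (.and (hf ?_ ?_) (.or (.eq ?_ ?_) (.eq ?_ ?_))))))) <;> fun_prop

theorem sig_atomicClause (n : ℕ) : Sig n AtomicClause := by
  have hv {α : Type} [Primcodable α] {f g : α → List ℕ} {h : α → ℕ} (hf : Primrec f)
      (hg : Primrec g) (hh : Primrec h) : Sig n fun a => henkinAlg.HasValue (f a) (g a) (h a) :=
    (henkinAlg.sig_hasValue (by fun_prop) (by fun_prop) (by fun_prop) n).comp
      (hf.pair (hg.pair hh))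
  refine .ex (.ex (.ex (.ex (.ex (.ex (.and (hv ?_ ?_ ?_) (.and (hv ?_ ?_ ?_)
    (.or (.eq ?_ ?_) (.eq ?_ ?_))))))))) <;> fun_prop

set_option maxHeartbeats 800000 in
theorem sig_eqClause (n : ℕ) : Sig n EqClause := by
  refine .or (.ex (.eq ?_ ?_)) (.or (.ex (.ex (.ex (.eq ?_ ?_)))) (.or (.ex (.ex (.eq ?_ ?_)))
    (.ex (.ex (.ex (.ex (.or (.eq ?_ ?_) (.or (.eq ?_ ?_) (.eq ?_ ?_))))))))) <;> fun_prop

theorem sig_henkinClause {n : ℕ} {A : List ℕ → Prop} (hA : Sig n A) : Sig n (HenkinClause A) := by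
  refine .or (sig_logicClause n) (.or (sig_atomicClause n) (.or (sig_eqClause n)
    (.ex (.and (hA.comp (f := fun x : List (Bool × ℕ) × List ℕ => x.2) ?_) (.eq ?_ ?_))))) <;>
    fun_prop

end Definability

/-! ### The standard valuation satisfies the Henkin clauses -/

/-- One step of the interpretation of the Henkin constants in `ℕ`. -/
noncomputable def interpStep (g : ℕ → ℕ) : ℕ → ℕ
  | 0 => 0
  | n + 1 => match n.unpair.1, n.unpair.2 with
    | 0, r => g r + 1
    | 1, r => g r.unpair.1 + g r.unpair.2
    | 2, r => g r.unpair.1 * g r.unpair.2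
    | _, r => match decode (α := List ℕ × List ℕ) r with
      | none => 0
      | some (l, e) => sInf {x | ∃ φ : LA.BoundedFormula Empty (e.length + 1), formCode φ = l ∧
          ¬ Holds φ (Fin.snoc (g ∘ val e) x : Fin (e.length + 1) → ℕ)}

/-- The interpretation of the Henkin constants in `ℕ`. -/
noncomputable def interp (n : ℕ) : ℕ :=
  interpStep (fun m => if _ : m < n then interp m else 0) n

theorem interp_zero : interp 0 = 0 := by
  rw [interp, interpStep]

theorem interp_succ (x : ℕ) : interp (henkinAlg.succ x) = interp x + 1 := by
  have h : x < Nat.pair 0 x + 1 := Nat.lt_succ_iff.2 (Nat.right_le_pair _ _)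
  rw [henkinAlg, interp]
  simp [interpStep, h]

theorem le_pair_pair (c x y : ℕ) :
    x ≤ Nat.pair c (Nat.pair x y) ∧ y ≤ Nat.pair c (Nat.pair x y) :=
  have h := Nat.right_le_pair c (Nat.pair x y)
  ⟨(Nat.left_le_pair x y).trans h, (Nat.right_le_pair x y).trans h⟩

theorem interp_add (x y : ℕ) : interp (henkinAlg.add x y) = interp x + interp y := by
  rw [henkinAlg, interp]
  simp [interpStep, le_pair_pair]

theorem interp_mul (x y : ℕ) : interp (henkinAlg.mul x y) = interp x * interp y := by
  rw [henkinAlg, interp]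
  simp [interpStep, le_pair_pair]

theorem val_lt_encode : ∀ (e : List ℕ) (i : Fin e.length), val e i < encode e
  | [], i => i.elim0
  | x :: e, i => by
    rw [encode_list_cons, Nat.lt_succ_iff]
    refine Fin.lastCases (n := e.length) ?_ (fun j => ?_) i
    · simpa [val] using Nat.left_le_pair _ _
    · simpa [val] using (val_lt_encode e j).le.trans (Nat.right_le_pair _ _)

theorem interp_wit {e : List ℕ} {φ : LA.BoundedFormula Empty (e.length + 1)} {x : ℕ}
    (h : ¬ Holds φ (Fin.snoc (interp ∘ val e) x : Fin (e.length + 1) → ℕ)) :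
    ¬ Holds φ
      (Fin.snoc (interp ∘ val e) (interp (wit (formCode φ) e)) : Fin (e.length + 1) → ℕ) := by
  have hw : interp (wit (formCode φ) e) = sInf {x | ∃ ψ : LA.BoundedFormula Empty (e.length + 1),
      formCode ψ = formCode φ ∧
        ¬ Holds ψ (Fin.snoc (interp ∘ val e) x : Fin (e.length + 1) → ℕ)} := by
    have hlt (i) : val e i < wit (formCode φ) e := by
      refine Nat.lt_succ_iff.2 ((val_lt_encode e i).le.trans ?_)
      exact (Nat.right_le_pair _ _).trans (Nat.right_le_pair 3 _)
    have hg : (fun m => if _ : m < wit (formCode φ) e then interp m else 0) ∘ val e =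
        interp ∘ val e := funext fun i => by simp [hlt i]
    rw [interp, ← hg]
    generalize (fun m => if _ : m < wit (formCode φ) e then interp m else 0) = g
    simp [interpStep, wit]
  rw [hw]
  obtain ⟨ψ, hψ, H⟩ := Nat.sInf_mem (s := {x | ∃ ψ : LA.BoundedFormula Empty (e.length + 1),
    formCode ψ = formCode φ ∧
      ¬ Holds ψ (Fin.snoc (interp ∘ val e) x : Fin (e.length + 1) → ℕ)}) ⟨x, φ, rfl, h⟩
  rwa [formCode_injective hψ] at H

theorem interp_eval {k : ℕ} (v : Fin k → ℕ) (t : LA.Term (Empty ⊕ Fin k)) :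
    interp (henkinAlg.eval v t) = value t (interp ∘ v) := by
  induction t using term_induction with
  | var a =>
    rcases a with a | i
    · exact a.elim
    · rfl
  | zero => exact interp_zero
  | succ t ih => exact (interp_succ _).trans (congrArg (· + 1) ih)
  | add t s iht ihs => exact (interp_add _ _).trans (congrArg₂ (· + ·) iht ihs)
  | mul t s iht ihs => exact (interp_mul _ _).trans (congrArg₂ (· * ·) iht ihs)

/-- The valuation of atoms given by truth in `ℕ`. -/
def stdVal (i : ℕ) : Prop :=
  ∃ (e : List ℕ) (φ : LA.BoundedFormula Empty e.length),
    i = atom (formCode φ) e ∧ Holds φ (interp ∘ val e)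

theorem stdVal_atom (e : List ℕ) (φ : LA.BoundedFormula Empty e.length) :
    stdVal (atom (formCode φ) e) ↔ Holds φ (interp ∘ val e) := by
  constructor
  · rintro ⟨e', ψ, h, H⟩
    obtain ⟨h, rfl⟩ := Prod.mk.inj (encode_injective h)
    rwa [formCode_injective h]
  · exact fun h => ⟨e, φ, rfl, h⟩

theorem stdVal_eqAtom (x y : ℕ) : stdVal (eqAtom x y) ↔ interp x = interp y := by
  have := stdVal_atom [y, x] ((&0 : LA.Term (Empty ⊕ Fin 2)) =' &1)
  rw [formCode_eq] at this
  exact this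

theorem stdVal_leAtom (x y : ℕ) : stdVal (leAtom x y) ↔ interp x ≤ interp y := by
  have := stdVal_atom [y, x] (leF (&0 : LA.Term (Empty ⊕ Fin 2)) &1)
  rw [formCode_leF] at this
  exact this

theorem exists_lit_stdVal {A : List ℕ → Prop}
    (hA : ∀ l, A l → ∃ φ : LA.Sentence, formCode φ = l ∧ ℕ ⊨ φ) {q : List (Bool × ℕ)}
    (hq : HenkinClause A q) : ∃ p ∈ q, Lit stdVal p := by
  rcases hq with hq | hq | hq | ⟨l, hl, rfl⟩
  · rcases hq with ⟨e, rfl⟩ | ⟨e, l, m, ⟨φ, rfl⟩, ⟨ψ, rfl⟩, hq⟩ | ⟨e, l, x, ⟨φ, rfl⟩, hq⟩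
    · simp [Lit, ← formCode_bot, stdVal_atom, Holds]
    · rcases hq with rfl | rfl | rfl <;>
        simp only [Lit, ← formCode_imp, stdVal_atom, Holds, realize_imp,
          List.exists_mem_cons_iff] <;>
        simp <;> tauto
    · have hx (x) : stdVal (atom (formCode φ) (x :: e)) ↔
          Holds φ (Fin.snoc (interp ∘ val e) (interp x) : Fin (e.length + 1) → ℕ) := by
        rw [← Fin.comp_snoc]
        exact stdVal_atom (x :: e) φ
      rcases hq with rfl | rfl
      · simp only [Lit, ← formCode_all, stdVal_atom, Holds, realize_all,
          List.exists_mem_cons_iff, hx]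
        by_cases H : ∀ a, φ.Realize (fun e => Empty.elim e) (Fin.snoc (interp ∘ val e) a) <;>
          simp [H]
      · simp only [Lit, ← formCode_all, stdVal_atom, List.exists_mem_cons_iff, hx]
        by_cases H : Holds φ.all (interp ∘ val e)
        · simp [H]
        · simp only [Holds, realize_all, not_forall] at H
          obtain ⟨x, h⟩ := H
          simp [interp_wit h]
  · obtain ⟨e, l, m, y, z, b, ⟨t, rfl, rfl⟩, ⟨u, rfl, rfl⟩, rfl | rfl⟩ := hq
    · cases b <;> simp [Lit, ← formCode_eq, stdVal_atom, stdVal_eqAtom, interp_eval, Holds] <;>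
        tauto
    · cases b <;> simp [Lit, ← formCode_leF, stdVal_atom, stdVal_leAtom, interp_eval, Holds]
      exacts [lt_or_ge _ _, le_or_gt _ _]
  · rcases hq with ⟨x, rfl⟩ | ⟨x, y, z, rfl⟩ | ⟨x, y, rfl⟩ | ⟨x, x', y, y', rfl | rfl | rfl⟩ <;>
      simp [Lit, stdVal_eqAtom, stdVal_leAtom, interp_succ, interp_add, interp_mul] <;> grind
  · obtain ⟨φ, rfl, h⟩ := hA l hl
    exact ⟨_, List.mem_cons_self,
      iff_of_true ((stdVal_atom [] φ).2 ((models_iff_holds φ _).1 h)) rfl⟩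

/-! ### The Henkin model of a valuation -/

/-- The valuation `W` satisfies the Henkin clauses of the theory with axioms coded by `A`. -/
def IsHenkin (A : List ℕ → Prop) (W : ℕ → Prop) : Prop :=
  ∀ q, HenkinClause A q → ∃ p ∈ q, Lit W p

variable {A : List ℕ → Prop} {W : ℕ → Prop}

namespace IsHenkin

theorem eq_clause (hW : IsHenkin A W) {q : List (Bool × ℕ)} (hq : EqClause q) :
    ∃ p ∈ q, Lit W p := hW q (.inr (.inr (.inl hq)))

theorem eq_refl (hW : IsHenkin A W) (x : ℕ) : W (eqAtom x x) := by
  simpa [Lit] using hW.eq_clause (.inl ⟨x, rfl⟩)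

theorem eq_eucl (hW : IsHenkin A W) {x y z : ℕ} (h : W (eqAtom x y)) (h' : W (eqAtom x z)) :
    W (eqAtom y z) := by
  simpa [Lit, h, h'] using hW.eq_clause (.inr (.inl ⟨x, y, z, rfl⟩))

/-- Equality of Henkin constants. -/
def setoid (hW : IsHenkin A W) : Setoid ℕ where
  r x y := W (eqAtom x y)
  iseqv := ⟨hW.eq_refl, fun {x _} h => hW.eq_eucl h (hW.eq_refl x),
    fun {x _ _} h₁ h₂ => hW.eq_eucl (hW.eq_eucl h₁ (hW.eq_refl x)) h₂⟩

/-- The model of equivalence classes of Henkin constants. -/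
def Model (hW : IsHenkin A W) : Type := Quotient hW.setoid

/-- The element of the Henkin model named by a constant. -/
def mk (hW : IsHenkin A W) (x : ℕ) : hW.Model := Quotient.mk hW.setoid x

theorem mk_eq_mk (hW : IsHenkin A W) {x y : ℕ} : hW.mk x = hW.mk y ↔ W (eqAtom x y) :=
  Quotient.eq (r := hW.setoid)

theorem mk_surjective (hW : IsHenkin A W) : Function.Surjective hW.mk := Quotient.mk_surjective

theorem succ_congr (hW : IsHenkin A W) {x y : ℕ} (h : W (eqAtom x y)) :
    W (eqAtom (henkinAlg.succ x) (henkinAlg.succ y)) := by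
  simpa [Lit, h] using hW.eq_clause (.inr (.inr (.inl ⟨x, y, rfl⟩)))

theorem add_congr (hW : IsHenkin A W) {x x' y y' : ℕ} (h : W (eqAtom x x')) (h' : W (eqAtom y y')) :
    W (eqAtom (henkinAlg.add x y) (henkinAlg.add x' y')) := by
  simpa [Lit, h, h'] using hW.eq_clause (.inr (.inr (.inr ⟨x, x', y, y', .inl rfl⟩)))

theorem mul_congr (hW : IsHenkin A W) {x x' y y' : ℕ} (h : W (eqAtom x x')) (h' : W (eqAtom y y')) :
    W (eqAtom (henkinAlg.mul x y) (henkinAlg.mul x' y')) := by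
  simpa [Lit, h, h'] using hW.eq_clause (.inr (.inr (.inr ⟨x, x', y, y', .inr (.inl rfl)⟩)))

theorem le_congr (hW : IsHenkin A W) {x x' y y' : ℕ} (h : W (eqAtom x x')) (h' : W (eqAtom y y'))
    (H : W (leAtom x y)) : W (leAtom x' y') := by
  simpa [Lit, h, h', H] using hW.eq_clause (.inr (.inr (.inr ⟨x, x', y, y', .inr (.inr rfl)⟩)))

instance (hW : IsHenkin A W) : LA.Structure hW.Model where
  funMap {_} f := match f with
    | ArithFunc.zero => fun _ => hW.mk henkinAlg.zero
    | ArithFunc.succ => fun v => Quotient.map (sa := hW.setoid) (sb := hW.setoid)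
        henkinAlg.succ (fun _ _ => hW.succ_congr) (v 0)
    | ArithFunc.add => fun v => Quotient.map₂ (sa := hW.setoid) (sb := hW.setoid) (sc := hW.setoid)
        henkinAlg.add (fun _ _ h _ _ h' => hW.add_congr h h') (v 0) (v 1)
    | ArithFunc.mul => fun v => Quotient.map₂ (sa := hW.setoid) (sb := hW.setoid) (sc := hW.setoid)
        henkinAlg.mul (fun _ _ h _ _ h' => hW.mul_congr h h') (v 0) (v 1)
  RelMap {_} r := match r with
    | ArithRel.le => fun v => Quotient.lift₂ (s₁ := hW.setoid) (s₂ := hW.setoid)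
        (fun x y => W (leAtom x y)) (fun _ _ _ _ h h' => propext
          ⟨hW.le_congr h h', hW.le_congr (hW.setoid.symm h) (hW.setoid.symm h')⟩) (v 0) (v 1)

theorem realize_term (hW : IsHenkin A W) {k : ℕ} (v : Fin k → ℕ) (t : LA.Term (Empty ⊕ Fin k)) :
    t.realize (Sum.elim (fun e => Empty.elim e) (hW.mk ∘ v)) = hW.mk (henkinAlg.eval v t) := by
  induction t using term_induction with
  | var a =>
    rcases a with a | i
    · exact a.elim
    · rfl
  | zero => rfl
  | succ t ih =>
    exact congrArg (Quotient.map (sa := hW.setoid) (sb := hW.setoid)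
      henkinAlg.succ fun _ _ => hW.succ_congr) ih
  | add t s iht ihs =>
    exact congrArg₂ (Quotient.map₂ (sa := hW.setoid) (sb := hW.setoid) (sc := hW.setoid)
      henkinAlg.add fun _ _ h _ _ h' => hW.add_congr h h') iht ihs
  | mul t s iht ihs =>
    exact congrArg₂ (Quotient.map₂ (sa := hW.setoid) (sb := hW.setoid) (sc := hW.setoid)
      henkinAlg.mul fun _ _ h _ _ h' => hW.mul_congr h h') iht ihs

theorem realize_leF_iff (hW : IsHenkin A W) {k : ℕ} (v : Fin k → ℕ)
    (t s : LA.Term (Empty ⊕ Fin k)) : (leF t s).Realize (fun e => Empty.elim e) (hW.mk ∘ v) ↔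
      W (leAtom (henkinAlg.eval v t) (henkinAlg.eval v s)) :=
  iff_of_eq (congrArg₂ (Quotient.lift₂ (s₁ := hW.setoid) (s₂ := hW.setoid)
    (fun x y => W (leAtom x y)) (fun _ _ _ _ h h' => propext
      ⟨hW.le_congr h h', hW.le_congr (hW.setoid.symm h) (hW.setoid.symm h')⟩))
    (hW.realize_term v t) (hW.realize_term v s))

/-- A formula holds in the Henkin model if and only if its atom is true. -/
theorem realize_iff (hW : IsHenkin A W) {k : ℕ} (φ : LA.BoundedFormula Empty k) :
    ∀ (e : List ℕ) (he : e.length = k),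
      (φ.Realize (fun e => Empty.elim e) (fun i => hW.mk (val e (Fin.cast he.symm i))) ↔
        W (atom (formCode φ) e)) := by
  induction φ using formula_induction with
  | falsum k =>
    rintro e rfl
    have := hW _ (.inl (.inl ⟨e, rfl⟩))
    simpa [Lit] using this
  | equal k t s =>
    rintro e rfl
    have h (b) := hW _ (.inr (.inl ⟨e, _, _, _, _, b, ⟨t, rfl, rfl⟩, ⟨s, rfl, rfl⟩, .inl rfl⟩))
    have ht := (congrArg₂ (· = ·) (hW.realize_term (val e) t) (hW.realize_term (val e) s))
    refine (iff_of_eq ht).trans (hW.mk_eq_mk.trans ?_)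
    have h₁ := h true
    have h₂ := h false
    rw [formCode_eq]
    simp [Lit] at h₁ h₂
    tauto
  | le k t s =>
    rintro e rfl
    have h (b) := hW _ (.inr (.inl ⟨e, _, _, _, _, b, ⟨t, rfl, rfl⟩, ⟨s, rfl, rfl⟩, .inr rfl⟩))
    refine (hW.realize_leF_iff (val e) t s).trans ?_
    have h₁ := h true
    have h₂ := h false
    rw [formCode_leF]
    simp [Lit] at h₁ h₂
    tauto
  | imp k φ ψ ihφ ihψ =>
    rintro e rfl
    have h {q} (hq) := hW q (.inl (.inr (.inl ⟨e, _, _, ⟨φ, rfl⟩, ⟨ψ, rfl⟩, hq⟩)))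
    have h₁ := h (.inl rfl)
    have h₂ := h (.inr (.inl rfl))
    have h₃ := h (.inr (.inr rfl))
    rw [realize_imp, ihφ e rfl, ihψ e rfl, formCode_imp]
    simp [Lit] at h₁ h₂ h₃
    tauto
  | all k φ ih =>
    rintro e rfl
    have h (x : ℕ) {q} (hq) := hW q (.inl (.inr (.inr ⟨e, _, x, ⟨φ, rfl⟩, hq⟩)))
    have hx (x : ℕ) := ih (x :: e) rfl
    have hs (x : ℕ) : (fun i => hW.mk (val (x :: e) i)) =
        (Fin.snoc (fun i => hW.mk (val e i)) (hW.mk x) : Fin (e.length + 1) → hW.Model) :=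
      Fin.comp_snoc hW.mk (val e) x
    simp only [Fin.cast_eq_self] at hx ⊢
    rw [realize_all, hW.mk_surjective.forall, formCode_all]
    simp only [← hs]
    refine (forall_congr' hx).trans ?_
    have h₂ := h 0 (.inr rfl)
    constructor
    · intro H
      simpa [Lit, H] using h₂
    · intro H x
      simpa [Lit, H] using h x (.inl rfl)

theorem models_iff (hW : IsHenkin A W) (φ : LA.Sentence) :
    hW.Model ⊨ φ ↔ W (atom (formCode φ) []) := by
  rw [← hW.realize_iff φ [] rfl]
  exact iff_of_eq (congrArg₂ (BoundedFormula.Realize (M := hW.Model) φ) (Subsingleton.elim _ _)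
    (Subsingleton.elim _ _))

instance (hW : IsHenkin A W) : Nonempty hW.Model := ⟨hW.mk 0⟩

end IsHenkin

/-! ### The complete extension -/

theorem models_of_mem_QTheory {φ : LA.Sentence} (h : φ ∈ QTheory) : ℕ ⊨ φ := by
  rcases h with rfl | rfl | rfl | rfl | rfl | rfl | rfl | rfl
  all_goals simp [Sentence.Realize, Formula.Realize, BoundedFormula.alls, Fin.snoc]
  exacts [fun _ => Nat.pos_of_ne_zero, fun _ _ => rfl, fun _ _ => rfl,
    fun _ _ => le_iff_exists_add'.trans (exists_congr fun _ => eq_comm)]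

/-- The codes of the axioms of `Q` and of the true `Πₙ`-sentences. -/
def BaseAxiom (n : ℕ) (l : List ℕ) : Prop :=
  Sat n true l [] ∨ ∃ φ ∈ QTheory, formCode φ = l

theorem sig_baseAxiom (n : ℕ) : Sig n (BaseAxiom n) := by
  refine .or ((sig_sat n).comp (f := fun l : List ℕ => (true, l, [])) (by fun_prop)) ?_
  have hfin : {l | ∃ φ ∈ QTheory, formCode φ = l}.Finite := by
    refine Set.Finite.image _ ?_
    simp [QTheory]
  exact (Sig.mem (f := fun _ => hfin.toFinset.toList) (g := fun l : List ℕ => l) (by fun_prop)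
    (by fun_prop)).congr fun l => by simp

theorem BaseAxiom.models {n : ℕ} {l : List ℕ} (h : BaseAxiom n l) :
    ∃ φ : LA.Sentence, formCode φ = l ∧ ℕ ⊨ φ := by
  rcases h with ⟨φ, -, h, H⟩ | ⟨φ, h, rfl⟩
  · exact ⟨φ, h, (models_iff_holds φ _).2 (H.2 rfl)⟩
  · exact ⟨φ, rfl, models_of_mem_QTheory h⟩

theorem BaseAxiom.of_isPi {n : ℕ} {φ : LA.Sentence} (h : IsPi n φ) (H : ℕ ⊨ φ) :
    BaseAxiom n (formCode φ) :=
  .inl ⟨φ, h.atLevel.inLevel true, rfl, iff_of_true ((models_iff_holds φ _).1 H) rfl⟩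

theorem IsHenkin.atom_of_mem {A : List ℕ → Prop} {W : ℕ → Prop} (hW : IsHenkin A W) {l : List ℕ}
    (h : A l) : W (atom l []) := by
  simpa [Lit] using hW _ (.inr (.inr (.inr ⟨l, h, rfl⟩)))

theorem Sig.sigmaDefinable {n : ℕ} {A : Set ℕ} (h : Sig n (· ∈ A)) : SigmaDefinable (n + 1) A := by
  obtain ⟨B, ⟨Ψ, hΨ, hB⟩, hA⟩ := h
  exact ⟨Ψ, hΨ, fun m => (hA m).trans (hB ![m]).symm⟩

/-- **Theorem 3.1.** There exists a complete (and consistent)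
`Σ_{n+2}`-definable extension of `Q + Πₙ-Th(ℕ)`. -/
theorem complete_sigmaDefinable_extension (n : ℕ) :
    ∃ T : LA.Theory, Consistent T ∧
      (∀ φ : LA.Sentence, Proves T φ ∨ Proves T (∼φ)) ∧
      ExtendsQ T ∧
      (∀ φ : LA.Sentence, IsPi n φ → ℕ ⊨ φ → Proves T φ) ∧
      SigmaDefinable (n + 2) (axiomCodes T) := by
  obtain ⟨W, hsig, hW⟩ := exists_sig_valuation _ (sig_henkinClause (sig_baseAxiom n))
    fun q => exists_lit_stdVal (A := BaseAxiom n) fun _ => BaseAxiom.models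
  replace hW : IsHenkin (BaseAxiom n) W := hW
  let T : LA.Theory := {φ | W (atom (formCode φ) [])}
  have hT (φ : LA.Sentence) : φ ∈ T ↔ hW.Model ⊨ φ := (hW.models_iff φ).symm
  have hmodel : hW.Model ⊨ T := ⟨fun φ hφ => (hT φ).1 hφ⟩
  have hproves {φ : LA.Sentence} (h : BaseAxiom n (formCode φ)) : Proves T φ :=
    Theory.models_sentence_of_mem (hW.atom_of_mem h)
  refine ⟨T, fun h => h.realize_sentence hW.Model, fun φ => ?_,
    fun φ hφ => hproves (.inr ⟨φ, hφ, rfl⟩), fun φ hφ H => hproves (.of_isPi hφ H),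
    Sig.sigmaDefinable ?_⟩
  · by_cases h : hW.Model ⊨ φ
    · exact .inl (Theory.models_sentence_of_mem ((hT φ).2 h))
    · exact .inr (Theory.models_sentence_of_mem ((hT _).2 h))
  · refine (Sig.ex (p := fun (m : ℕ) (l : List ℕ) => m = encode l ∧ IsFormCode 0 l ∧ W (atom l []))
      (.and (.eq ?_ ?_) (.and ((sig_isFormCode _).comp (f := fun x : ℕ × List ℕ => (0, x.2)) ?_)
        (hsig.comp (f := fun x : ℕ × List ℕ => atom x.2 []) ?_)))).congr fun m => ?_
    any_goals fun_prop
    constructor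
    · rintro ⟨_, rfl, ⟨φ, rfl⟩, h⟩
      exact ⟨φ, h, godel_eq φ⟩
    · rintro ⟨φ, h, rfl⟩
      exact ⟨_, godel_eq φ, ⟨φ, rfl⟩, h⟩

end GRNonRE
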